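/- Fix 0 < σ < 1 and let 𝒩 = {(x₁,x₂,x₃) ∈ ℝ³ : x₂² + x₃² ≤ x₁^{−σ/2}, x₁ > 0}. Let p : ℝ³ → [1,∞] be a measurable exponent such that 3 < ess inf_{ℝ³∖𝒩} p ≤ ess sup_{ℝ³∖𝒩} p < 9/2 and p(x) = ∞ for every x ∈ 𝒩. If (u, P) is a weak solution of the stationary Navier–Stokes equations on ℝ³ with u ∈ L^{p(·)}(ℝ³) and P ∈ L^{p(·)/2}(ℝ³), then u = 0 almost everywhere. -/

import Mathlib

open MeasureTheory Filter Metric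
open scoped ENNReal Topology NNReal

noncomputable section

/-- `ℝ³` as a Euclidean space (coordinates `x 0, x 1, x 2` standing for `x₁, x₂, x₃`). -/
abbrev E3 : Type := EuclideanSpace ℝ (Fin 3)

/-- Partial derivative `∂ᵢ g` of a scalar function on `ℝ³`. -/
def pd (i : Fin 3) (g : E3 → ℝ) (x : E3) : ℝ :=
  fderiv ℝ g x (EuclideanSpace.single i 1)

/-- Laplacian of a scalar function on `ℝ³`. -/
def lap3 (g : E3 → ℝ) (x : E3) : ℝ := ∑ i : Fin 3, pd i (pd i g) x

/-- The modular `ρ_{p(·)}(f) = ∫ |f|^{p(x)} dx` for a finite real-valued variable exponent. -/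
def modularV (p : E3 → ℝ) (f : E3 → ℝ) : ℝ≥0∞ :=
  ∫⁻ x, ENNReal.ofReal (|f x| ^ p x)

/-- Membership in the variable exponent Lebesgue space `L^{p(·)}(ℝ³)`
(finiteness of the Luxemburg norm). -/
def MemVarLp (p : E3 → ℝ) (f : E3 → ℝ) : Prop :=
  ∃ l : ℝ, 0 < l ∧ modularV p (fun x => f x / l) ≤ 1

/-- The Luxemburg norm `‖f‖_{L^{p(·)}(ℝ³)}`. -/
def varLpNorm (p : E3 → ℝ) (f : E3 → ℝ) : ℝ :=
  sInf {l : ℝ | 0 < l ∧ modularV p (fun x => f x / l) ≤ 1}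

/-- `(u, P)` is a weak solution of the stationary Navier–Stokes equations
`Δu − (u·∇)u − ∇P = 0`, `div u = 0` on `ℝ³`. -/
def IsWeakSolutionNS (u : E3 → E3) (P : E3 → ℝ) : Prop :=
  (∀ φ : E3 → E3, ContDiff ℝ (⊤ : ℕ∞) φ → HasCompactSupport φ →
      ((∫ x, ∑ j : Fin 3, u x j * lap3 (fun y => φ y j) x) +
        (∑ i : Fin 3, ∑ j : Fin 3, ∫ x, u x i * u x j * pd i (fun y => φ y j) x) +
        (∫ x, P x * ∑ j : Fin 3, pd j (fun y => φ y j) x) = 0)) ∧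
  (∀ ψ : E3 → ℝ, ContDiff ℝ (⊤ : ℕ∞) ψ → HasCompactSupport ψ →
      (∫ x, ∑ j : Fin 3, u x j * pd j ψ x) = 0)

/-- The infinite cylinder `𝒞 = {x ∈ ℝ³ : x₂² + x₃² ≤ 1}`. -/
def cylC : Set E3 := {x | (x 1) ^ 2 + (x 2) ^ 2 ≤ 1}


/-- The modular for a possibly infinite variable exponent `p : ℝ³ → [1,∞]`, with the
convention `|t|^∞ = 0` if `|t| ≤ 1` and `|t|^∞ = ∞` if `|t| > 1`. -/
def modularE (p : E3 → ℝ≥0∞) (f : E3 → ℝ) : ℝ≥0∞ :=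
  ∫⁻ x, if p x = ⊤ then (if |f x| ≤ 1 then 0 else ⊤)
        else ENNReal.ofReal (|f x| ^ (p x).toReal)

/-- Membership in `L^{p(·)}(ℝ³)` for a possibly infinite exponent. -/
def MemVarLpE (p : E3 → ℝ≥0∞) (f : E3 → ℝ) : Prop :=
  ∃ l : ℝ, 0 < l ∧ modularE p (fun x => f x / l) ≤ 1

/-- The shrinking region `𝒩 = {x ∈ ℝ³ : x₂² + x₃² ≤ x₁^{-σ/2}, x₁ > 0}`. -/
def setN (σ : ℝ) : Set E3 := {x | 0 < x 0 ∧ (x 1) ^ 2 + (x 2) ^ 2 ≤ (x 0) ^ (-(σ / 2))}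

/-- `f` is smooth. -/
abbrev Sm (f : E3 → ℝ) : Prop := ContDiff ℝ (⊤ : ℕ∞) f

lemma Sm.diff {f : E3 → ℝ} (hf : Sm f) : Differentiable ℝ f := hf.differentiable (by simp)

lemma Sm.dpd {f : E3 → ℝ} (hf : Sm f) (i : Fin 3) : Sm (pd i f) := by
  unfold pd
  exact (hf.fderiv_right (m := (⊤ : ℕ∞)) (by simp)).clm_apply contDiff_const

lemma Sm.dlap {f : E3 → ℝ} (hf : Sm f) : Sm (lap3 f) := by
  unfold lap3
  exact ContDiff.sum fun i _ => (hf.dpd i).dpd i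

lemma pd_add {i : Fin 3} {f g : E3 → ℝ} {x : E3} (hf : DifferentiableAt ℝ f x) (hg : DifferentiableAt ℝ g x) :
    pd i (fun y => f y + g y) x = pd i f x + pd i g x := by
  simp [pd, fderiv_fun_add hf hg]

lemma pd_sub {i : Fin 3} {f g : E3 → ℝ} {x : E3} (hf : DifferentiableAt ℝ f x) (hg : DifferentiableAt ℝ g x) :
    pd i (fun y => f y - g y) x = pd i f x - pd i g x := by
  simp [pd, fderiv_fun_sub hf hg]

lemma pd_mul {i : Fin 3} {f g : E3 → ℝ} {x : E3} (hf : DifferentiableAt ℝ f x) (hg : DifferentiableAt ℝ g x) :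
    pd i (fun y => f y * g y) x = pd i f x * g x + f x * pd i g x := by
  simp [pd, fderiv_fun_mul hf hg]; ring

lemma pd_const {i : Fin 3} (c : ℝ) (x : E3) : pd i (fun _ => c) x = 0 := by
  simp [pd]

lemma pd_coord (i j : Fin 3) (x : E3) : pd i (fun y => y j) x = if i = j then 1 else 0 := by
  have : (fun y : E3 => y j) = (EuclideanSpace.proj j : E3 →L[ℝ] ℝ) := rfl
  rw [pd, this, ContinuousLinearMap.fderiv]
  simp [eq_comm]

lemma diff_coord (j : Fin 3) : Differentiable ℝ (fun y : E3 => y j) := 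
  (EuclideanSpace.proj j : E3 →L[ℝ] ℝ).differentiable

lemma sm_coord (j : Fin 3) : Sm (fun y : E3 => y j) := 
  (EuclideanSpace.proj j : E3 →L[ℝ] ℝ).contDiff

lemma pd_hcs {f : E3 → ℝ} (hf : HasCompactSupport f) (i : Fin 3) : HasCompactSupport (pd i f) := by
  exact hf.fderiv_apply ℝ _

lemma pd_zero_of_notMem {f : E3 → ℝ} {x : E3} (hx : x ∉ tsupport f) (i : Fin 3) : pd i f x = 0 := by
  have := fderiv_of_notMem_tsupport (𝕜 := ℝ) hx
  simp [pd, this]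

lemma tsupport_pd {f : E3 → ℝ} (i : Fin 3) : tsupport (pd i f) ⊆ tsupport f := by
  apply closure_minimal _ (isClosed_tsupport f)
  intro x hx
  by_contra h
  exact hx (pd_zero_of_notMem h i)

lemma lap3_hcs {f : E3 → ℝ} (hf : HasCompactSupport f) : HasCompactSupport (lap3 f) := by
  apply HasCompactSupport.intro hf (fun x hx => ?_)
  unfold lap3
  refine Finset.sum_eq_zero fun i _ => ?_
  exact pd_zero_of_notMem (fun h => hx (tsupport_pd i h)) i

/-- Integration by parts. -/
lemma ibp {f g : E3 → ℝ} (hf : Sm f) (hg : Sm g) (hc : HasCompactSupport g) (i : Fin 3) :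
    ∫ x, f x * pd i g x = - ∫ x, pd i f x * g x := by
  unfold pd
  apply integral_mul_fderiv_eq_neg_fderiv_mul_of_integrable
  · exact ((hf.dpd i).continuous.mul hg.continuous).integrable_of_hasCompactSupport hc.mul_left
  · exact (hf.continuous.mul (hg.dpd i).continuous).integrable_of_hasCompactSupport (pd_hcs hc i).mul_left
  · exact (hf.continuous.mul hg.continuous).integrable_of_hasCompactSupport hc.mul_left
  · intro x _; exact hf.diff x
  · intro x _; exact hg.diff x

/-- translation -/
lemma pd_comp_sub (i : Fin 3) (f : E3 → ℝ) (a x : E3) :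
    pd i (fun y => f (y - a)) x = pd i f (x - a) := by
  simp [pd, fderiv_comp_sub]

lemma pd_comp_rsub (i : Fin 3) (f : E3 → ℝ) (hf : Differentiable ℝ f) (a x : E3) :
    pd i (fun y => f (a - y)) x = - pd i f (a - x) := by
  unfold pd
  have h1 : HasFDerivAt (fun y : E3 => a - y) (-(ContinuousLinearMap.id ℝ E3)) x := by
    simpa using (hasFDerivAt_id x).const_sub a
  have h2 := ((hf (a - x)).hasFDerivAt).comp x h1
  have : (fun y => f (a - y)) = f ∘ (fun y => a - y) := rfl
  rw [this, h2.fderiv]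
  simp

lemma integral_pd_zero {g : E3 → ℝ} (hg : Sm g) (hc : HasCompactSupport g) (i : Fin 3) :
    ∫ x, pd i g x = 0 := by
  have := ibp (f := fun _ => 1) contDiff_const hg hc i
  simpa [pd_const] using this

/-- the right-hand side density of the local energy identity -/
def eRHS (v : Fin 3 → E3 → ℝ) (F : Fin 3 → Fin 3 → E3 → ℝ) (p ζ : E3 → ℝ) (x : E3) : ℝ :=
  1 / 2 * lap3 ζ x * (∑ j, v j x ^ 2) + ∑ i, ∑ j, pd i ζ x * v j x * (F i j x - v i x * v j x)
    + ∑ i, ∑ j, ζ x * pd i (v j) x * (F i j x - v i x * v j x)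
    + (1 / 2 * (∑ j, v j x ^ 2) + p x) * ∑ i, v i x * pd i ζ x

lemma energy_id (v : Fin 3 → E3 → ℝ) (F : Fin 3 → Fin 3 → E3 → ℝ) (p ζ : E3 → ℝ)
    (hv : ∀ j, Sm (v j)) (hF : ∀ i j, Sm (F i j)) (hp : Sm p) (hζ : Sm ζ)
    (hc : HasCompactSupport ζ) (hdiv : ∀ x, ∑ j, pd j (v j) x = 0)
    (heq : ∀ j x, lap3 (v j) x = ∑ i, pd i (F i j) x + pd j p x) :
    ∫ x, ζ x * ∑ i, ∑ j, pd i (v j) x ^ 2 = ∫ x, eRHS v F p ζ x := by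
  let W : Fin 3 → E3 → ℝ := fun i x =>
    ζ x * (v 0 x * pd i (v 0) x + v 1 x * pd i (v 1) x + v 2 x * pd i (v 2) x)
    - 1 / 2 * (pd i ζ x * (v 0 x * v 0 x + v 1 x * v 1 x + v 2 x * v 2 x))
    - ζ x * (v 0 x * (F i 0 x - v i x * v 0 x) + v 1 x * (F i 1 x - v i x * v 1 x)
        + v 2 x * (F i 2 x - v i x * v 2 x))
    - 1 / 2 * (ζ x * (v i x * (v 0 x * v 0 x + v 1 x * v 1 x + v 2 x * v 2 x)))
    - ζ x * (p x * v i x)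
  have hvp : ∀ i j, Sm (pd i (v j)) := fun i j => (hv j).dpd i
  have hζp : ∀ i, Sm (pd i ζ) := fun i => hζ.dpd i
  have hWs : ∀ i, Sm (W i) := by
    intro i
    have := hvp i; have := hζp i; have := hF i
    unfold Sm at *
    simp only [W]
    fun_prop
  have hWc : ∀ i, HasCompactSupport (W i) := by
    intro i
    apply HasCompactSupport.intro hc (fun x hx => ?_)
    have h1 : ζ x = 0 := image_eq_zero_of_notMem_tsupport hx
    have h2 : pd i ζ x = 0 := pd_zero_of_notMem hx i
    simp [W, h1, h2]
  have dv : ∀ j, Differentiable ℝ (v j) := fun j => (hv j).diff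
  have dvp : ∀ i j, Differentiable ℝ (pd i (v j)) := fun i j => (hvp i j).diff
  have dF : ∀ i j, Differentiable ℝ (F i j) := fun i j => (hF i j).diff
  have dp := hp.diff
  have dζ := hζ.diff
  have dζp : ∀ i, Differentiable ℝ (pd i ζ) := fun i => (hζp i).diff
  have key : ∀ x, ζ x * ∑ i, ∑ j, pd i (v j) x ^ 2 = eRHS v F p ζ x + ∑ i, pd i (W i) x := by
    intro x
    have h0 := heq 0 x
    have h1 := heq 1 x
    have h2 := heq 2 x
    have hd := hdiv x
    simp only [eRHS, W]
    simp (disch := fun_prop) only [lap3, Fin.sum_univ_three, pd_add, pd_sub, pd_mul, pd_const] at *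
    linear_combination (-ζ x * v 0 x) * h0 + (-ζ x * v 1 x) * h1 + (-ζ x * v 2 x) * h2 +
      (ζ x * p x - ζ x * (1/2) * (v 0 x * v 0 x + v 1 x * v 1 x + v 2 x * v 2 x)) * hd
  have hintg : ∀ i, Integrable (pd i (W i)) := fun i =>
    ((hWs i).dpd i).continuous.integrable_of_hasCompactSupport (pd_hcs (hWc i) i)
  have hI2 : Integrable (fun x => ∑ i, pd i (W i) x) := integrable_finsetSum _ fun i _ => hintg i
  have hI3 : Integrable (fun x => ζ x * ∑ i, ∑ j, pd i (v j) x ^ 2) := by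
    apply Continuous.integrable_of_hasCompactSupport
    · refine hζ.continuous.mul ?_
      exact continuous_finsetSum _ fun i _ => continuous_finsetSum _ fun j _ => (hvp i j).continuous.pow 2
    · exact hc.mul_right
  have hI1 : Integrable (eRHS v F p ζ) := by
    have : eRHS v F p ζ = fun x => ζ x * ∑ i, ∑ j, pd i (v j) x ^ 2 - ∑ i, pd i (W i) x := by
      funext x; rw [key]; ring
    rw [this]; exact hI3.sub hI2
  calc _ = ∫ x, (eRHS v F p ζ x + ∑ i, pd i (W i) x) := by simp_rw [key]
    _ = _ := by
      rw [integral_add hI1 hI2, integral_finsetSum _ fun i _ => hintg i]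
      simp [integral_pd_zero (hWs _) (hWc _)]


def eBd (v : Fin 3 → E3 → ℝ) (F : Fin 3 → Fin 3 → E3 → ℝ) (p : E3 → ℝ) (c1 c2 : ℝ) (x : E3) : ℝ :=
  c2 * (∑ j, v j x ^ 2) + 2 * c1 * ∑ i, ∑ j, |v j x| * |F i j x - v i x * v j x|
    + ∑ i, ∑ j, (F i j x - v i x * v j x) ^ 2
    + c1 * ((∑ j, v j x ^ 2) + 2 * |p x|) * ∑ i, |v i x|

lemma eBd_nonneg (v : Fin 3 → E3 → ℝ) (F : Fin 3 → Fin 3 → E3 → ℝ) (p : E3 → ℝ) {c1 c2 : ℝ}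
    (h1 : 0 ≤ c1) (h2 : 0 ≤ c2) (x : E3) : 0 ≤ eBd v F p c1 c2 x := by
  unfold eBd; positivity

lemma energy_pt (v : Fin 3 → E3 → ℝ) (F : Fin 3 → Fin 3 → E3 → ℝ) (p ζ : E3 → ℝ) (c1 c2 : ℝ) (x : E3)
    (h0 : 0 ≤ ζ x) (h1 : ζ x ≤ 1) (hc1 : ∀ i, |pd i ζ x| ≤ c1) (hc2 : |lap3 ζ x| ≤ c2) :
    2 * eRHS v F p ζ x ≤ eBd v F p c1 c2 x + ζ x * ∑ i, ∑ j, pd i (v j) x ^ 2 := by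
  unfold eRHS eBd
  have A : 1 / 2 * lap3 ζ x * (∑ j, v j x ^ 2) ≤ 1 / 2 * c2 * (∑ j, v j x ^ 2) := by
    gcongr
    exact (le_abs_self _).trans hc2
  have B : ∑ i, ∑ j, pd i ζ x * v j x * (F i j x - v i x * v j x)
      ≤ c1 * ∑ i, ∑ j, |v j x| * |F i j x - v i x * v j x| := by
    rw [Finset.mul_sum]
    refine Finset.sum_le_sum fun i _ => ?_
    rw [Finset.mul_sum]
    refine Finset.sum_le_sum fun j _ => ?_
    refine (le_abs_self _).trans ?_
    rw [abs_mul, abs_mul, mul_assoc]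
    gcongr
    exact hc1 i
  have C : 2 * ∑ i, ∑ j, ζ x * pd i (v j) x * (F i j x - v i x * v j x)
      ≤ ζ x * ∑ i, ∑ j, pd i (v j) x ^ 2 + ∑ i, ∑ j, (F i j x - v i x * v j x) ^ 2 := by
    rw [Finset.mul_sum, Finset.mul_sum, ← Finset.sum_add_distrib]
    refine Finset.sum_le_sum fun i _ => ?_
    rw [Finset.mul_sum, Finset.mul_sum, ← Finset.sum_add_distrib]
    refine Finset.sum_le_sum fun j _ => ?_
    generalize F i j x - v i x * v j x = r
    generalize pd i (v j) x = d
    nlinarith [mul_nonneg h0 (sq_nonneg (d - r)), mul_nonneg (sub_nonneg.2 h1) (sq_nonneg r)]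
  have D : (1 / 2 * (∑ j, v j x ^ 2) + p x) * ∑ i, v i x * pd i ζ x
      ≤ (1 / 2 * (∑ j, v j x ^ 2) + |p x|) * (c1 * ∑ i, |v i x|) := by
    refine (le_abs_self _).trans ?_
    rw [abs_mul]
    gcongr
    · refine (abs_add_le _ _).trans ?_
      gcongr
      rw [abs_of_nonneg (by positivity)]
    · rw [Finset.mul_sum]
      refine (Finset.abs_sum_le_sum_abs _ _).trans (Finset.sum_le_sum fun i _ => ?_)
      rw [abs_mul, mul_comm]
      gcongr
      exact hc1 i
  nlinarith [A, B, C, D]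

lemma energy_ineq (v : Fin 3 → E3 → ℝ) (F : Fin 3 → Fin 3 → E3 → ℝ) (p ζ : E3 → ℝ)
    (hv : ∀ j, Sm (v j)) (hF : ∀ i j, Sm (F i j)) (hp : Sm p) (hζ : Sm ζ)
    (hdiv : ∀ x, ∑ j, pd j (v j) x = 0)
    (heq : ∀ j x, lap3 (v j) x = ∑ i, pd i (F i j) x + pd j p x)
    (ρ c1 c2 : ℝ) (hs : tsupport ζ ⊆ closedBall 0 ρ)
    (h0 : ∀ x, 0 ≤ ζ x) (h1 : ∀ x, ζ x ≤ 1) (hc1 : ∀ i x, |pd i ζ x| ≤ c1) (hc2 : ∀ x, |lap3 ζ x| ≤ c2) :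
    ∫ x, ζ x * ∑ i, ∑ j, pd i (v j) x ^ 2 ≤ ∫ x in closedBall 0 ρ, eBd v F p c1 c2 x := by
  have hc : HasCompactSupport ζ := HasCompactSupport.of_support_subset_isCompact
    (isCompact_closedBall 0 ρ) ((subset_tsupport _).trans hs)
  have id := energy_id v F p ζ hv hF hp hζ hc hdiv heq
  have hvp : ∀ i j, Continuous (pd i (v j)) := fun i j => ((hv j).dpd i).continuous
  have hζp : ∀ i, Continuous (pd i ζ) := fun i => (hζ.dpd i).continuous
  have hζl : Continuous (lap3 ζ) := hζ.dlap.continuous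
  have cv := fun j => (hv j).continuous
  have cF := fun i j => (hF i j).continuous
  have cp := hp.continuous
  have cζ := hζ.continuous
  have I1 : Integrable (fun x => ζ x * ∑ i, ∑ j, pd i (v j) x ^ 2) :=
    Continuous.integrable_of_hasCompactSupport (by fun_prop) hc.mul_right
  have I3 : Integrable (eRHS v F p ζ) := by
    apply Continuous.integrable_of_hasCompactSupport
    · unfold eRHS; fun_prop
    · apply HasCompactSupport.intro hc (fun x hx => ?_)
      have h1 : ζ x = 0 := image_eq_zero_of_notMem_tsupport hx
      have h2 : ∀ i, pd i ζ x = 0 := pd_zero_of_notMem hx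
      have h3 : lap3 ζ x = 0 := by
        unfold lap3
        exact Finset.sum_eq_zero fun i _ => pd_zero_of_notMem (fun h => hx (tsupport_pd i h)) i
      simp [eRHS, h1, h2, h3]
  have I2 : IntegrableOn (eBd v F p c1 c2) (closedBall 0 ρ) := by
    have : Continuous (eBd v F p c1 c2) := by unfold eBd; fun_prop
    exact this.continuousOn.integrableOn_compact (isCompact_closedBall 0 ρ)
  have z : ∀ x ∉ closedBall (0 : E3) ρ, ζ x = 0 := fun x hx =>
    image_eq_zero_of_notMem_tsupport (fun h => hx (hs h))
  have E1 : ∫ x, ζ x * ∑ i, ∑ j, pd i (v j) x ^ 2 =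
      ∫ x in closedBall 0 ρ, ζ x * ∑ i, ∑ j, pd i (v j) x ^ 2 := by
    rw [setIntegral_eq_integral_of_forall_compl_eq_zero]
    intro x hx; simp [z x hx]
  have E2 : ∫ x, eRHS v F p ζ x = ∫ x in closedBall 0 ρ, eRHS v F p ζ x := by
    rw [setIntegral_eq_integral_of_forall_compl_eq_zero]
    intro x hx
    have hx : x ∉ tsupport ζ := fun h => hx (hs h)
    have h1 : ζ x = 0 := image_eq_zero_of_notMem_tsupport hx
    have h2 : ∀ i, pd i ζ x = 0 := pd_zero_of_notMem hx
    have h3 : lap3 ζ x = 0 := by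
      unfold lap3
      exact Finset.sum_eq_zero fun i _ => pd_zero_of_notMem (fun h => hx (tsupport_pd i h)) i
    simp [eRHS, h1, h2, h3]
  have M : ∫ x in closedBall 0 ρ, 2 * eRHS v F p ζ x ≤
      ∫ x in closedBall 0 ρ, (eBd v F p c1 c2 x + ζ x * ∑ i, ∑ j, pd i (v j) x ^ 2) := by
    apply integral_mono (I3.integrableOn.const_mul 2) (I2.add I1.integrableOn)
    intro x
    exact energy_pt v F p ζ c1 c2 x (h0 x) (h1 x) (fun i => hc1 i x) (hc2 x)
  rw [integral_const_mul, integral_add I2 I1.integrableOn, ← E1, ← E2, ← id] at M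
  linarith

lemma young_aux (G w : E3 → ℝ≥0∞) (hG : Measurable G) (hw : Measurable w) (s t r : ℝ)
    (hs : 1 ≤ s) (ht : 1 ≤ t) (hr : 0 < r) (h : 1 / s + 1 / t = 1 + 1 / r) :
    ∫⁻ x, (∫⁻ y, G (x - y) * w y) ^ r ≤
      ((∫⁻ x, G x ^ s) * (∫⁻ x, w x ^ t)) * ((∫⁻ x, G x ^ s) ^ (r / s - 1) * (∫⁻ x, w x ^ t) ^ (r / t - 1)) := by
  have hs0 : 0 < s := by linarith
  have ht0 : 0 < t := by linarith
  have h1s : 1 / s ≤ 1 := by rw [div_le_one hs0]; exact hs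
  have h1t : 1 / t ≤ 1 := by rw [div_le_one ht0]; exact ht
  have hrr : 0 < 1 / r := by positivity
  set A := ∫⁻ x, G x ^ s with hA
  set B := ∫⁻ x, w x ^ t with hB
  have step : ∀ x, (∫⁻ y, G (x - y) * w y) ^ r ≤ (∫⁻ y, G (x - y) ^ s * w y ^ t) * (A ^ (r / s - 1) * B ^ (r / t - 1)) := by
    intro x
    have hAx : ∫⁻ y, G (x - y) ^ s = A := by
      rw [hA, ← lintegral_sub_left_eq_self (fun y => G y ^ s) x]
    have mG : Measurable (fun y => G (x - y)) := hG.comp (measurable_const.sub measurable_id)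
    have hold := ENNReal.lintegral_prod_norm_pow_le (μ := (volume : Measure E3)) (Finset.univ : Finset (Fin 3))
      (f := ![fun y => G (x - y) ^ s * w y ^ t, fun y => G (x - y) ^ s, fun y => w y ^ t])
      (p := ![1 / r, 1 / s - 1 / r, 1 / t - 1 / r])
      (by
        intro i _; fin_cases i
        · exact ((mG.pow_const s).mul (hw.pow_const t)).aemeasurable
        · exact (mG.pow_const s).aemeasurable
        · exact (hw.pow_const t).aemeasurable)
      (by simp [Fin.sum_univ_three] at *; linarith)
      (by intro i _; fin_cases i <;> simp at * <;> linarith)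
    simp only [Fin.prod_univ_three, Matrix.cons_val_zero, Matrix.cons_val_one, Matrix.cons_val] at hold
    have e : ∀ y, (G (x - y) ^ s * w y ^ t) ^ (1 / r) * (G (x - y) ^ s) ^ (1 / s - 1 / r) * (w y ^ t) ^ (1 / t - 1 / r)
        = G (x - y) * w y := by
      intro y
      rw [ENNReal.mul_rpow_of_nonneg _ _ hrr.le, ← ENNReal.rpow_mul, ← ENNReal.rpow_mul, ← ENNReal.rpow_mul,
        ← ENNReal.rpow_mul]
      have e1 : G (x - y) ^ (s * (1 / r)) * G (x - y) ^ (s * (1 / s - 1 / r)) = G (x - y) := by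
        rw [← ENNReal.rpow_add_of_nonneg _ _ (by positivity) (mul_nonneg hs0.le (by linarith)),
          show s * (1 / r) + s * (1 / s - 1 / r) = 1 by field_simp; ring, ENNReal.rpow_one]
      have e2 : w y ^ (t * (1 / r)) * w y ^ (t * (1 / t - 1 / r)) = w y := by
        rw [← ENNReal.rpow_add_of_nonneg _ _ (by positivity) (mul_nonneg ht0.le (by linarith)),
          show t * (1 / r) + t * (1 / t - 1 / r) = 1 by field_simp; ring, ENNReal.rpow_one]
      calc _ = (G (x - y) ^ (s * (1 / r)) * G (x - y) ^ (s * (1 / s - 1 / r))) *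
            (w y ^ (t * (1 / r)) * w y ^ (t * (1 / t - 1 / r))) := by ring
        _ = _ := by rw [e1, e2]
    simp_rw [e] at hold
    rw [hAx] at hold
    calc _ ≤ _ := ENNReal.rpow_le_rpow hold hr.le
      _ = _ := by
        rw [ENNReal.mul_rpow_of_nonneg _ _ hr.le, ENNReal.mul_rpow_of_nonneg _ _ hr.le,
          ← ENNReal.rpow_mul, ← ENNReal.rpow_mul, ← ENNReal.rpow_mul,
          show 1 / r * r = 1 by field_simp, show (1 / s - 1 / r) * r = r / s - 1 by field_simp,
          show (1 / t - 1 / r) * r = r / t - 1 by field_simp, ENNReal.rpow_one, mul_assoc]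
  have hmm : Measurable (Function.uncurry fun (x y : E3) => G (x - y) ^ s * w y ^ t) := by
    apply Measurable.mul
    · exact (hG.comp (measurable_fst.sub measurable_snd)).pow_const s
    · exact (hw.comp measurable_snd).pow_const t
  calc _ ≤ ∫⁻ x, (∫⁻ y, G (x - y) ^ s * w y ^ t) * (A ^ (r / s - 1) * B ^ (r / t - 1)) := lintegral_mono step
    _ = (∫⁻ x, ∫⁻ y, G (x - y) ^ s * w y ^ t) * (A ^ (r / s - 1) * B ^ (r / t - 1)) := by
        rw [lintegral_mul_const]
        exact hmm.lintegral_prod_right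
    _ = _ := by
        congr 1
        rw [lintegral_lintegral_swap hmm.aemeasurable]
        have : ∀ y : E3, ∫⁻ x, G (x - y) ^ s * w y ^ t = A * w y ^ t := by
          intro y
          have mG : Measurable (fun x => G (x - y) ^ s) := by fun_prop
          rw [lintegral_mul_const _ mG, hA,
            lintegral_sub_right_eq_self (fun x => G x ^ s) y]
        simp_rw [this]
        rw [lintegral_const_mul _ (hw.pow_const t)]

lemma young_lt_top (G w : E3 → ℝ≥0∞) (hG : Measurable G) (hw : Measurable w) (s t r : ℝ)
    (hs : 1 ≤ s) (ht : 1 ≤ t) (hr : 0 < r) (h : 1 / s + 1 / t = 1 + 1 / r)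
    (hGs : ∫⁻ x, G x ^ s < ⊤) (hwt : ∫⁻ x, w x ^ t < ⊤) :
    ∫⁻ x, (∫⁻ y, G (x - y) * w y) ^ r < ⊤ := by
  have hs0 : 0 < s := by linarith
  have ht0 : 0 < t := by linarith
  have h1s : 1 / s ≤ 1 := by rw [div_le_one hs0]; exact hs
  have h1t : 1 / t ≤ 1 := by rw [div_le_one ht0]; exact ht
  refine (young_aux G w hG hw s t r hs ht hr h).trans_lt ?_
  refine ENNReal.mul_lt_top (ENNReal.mul_lt_top hGs hwt) (ENNReal.mul_lt_top ?_ ?_)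
  · refine ENNReal.rpow_lt_top_of_nonneg ?_ hGs.ne
    have : r / s - 1 = r * (1 / s - 1 / r) := by field_simp
    rw [this]; exact mul_nonneg hr.le (by linarith)
  · refine ENNReal.rpow_lt_top_of_nonneg ?_ hwt.ne
    have : r / t - 1 = r * (1 / t - 1 / r) := by field_simp
    rw [this]; exact mul_nonneg hr.le (by linarith)

lemma young_mollify (G w : E3 → ℝ≥0∞) (hG : Measurable G) (hw : Measurable w) (r : ℝ)
    (hr : 1 ≤ r) (h1 : ∫⁻ x, G x = 1) :
    ∫⁻ x, (∫⁻ y, G (x - y) * w y) ^ r ≤ ∫⁻ x, w x ^ r := by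
  have := young_aux G w hG hw 1 r r le_rfl hr (by linarith) (by norm_num)
  simpa [h1, div_self (by linarith : r ≠ 0)] using this

/-- Hölder, endpoint case -/
lemma young_sup (G w : E3 → ℝ≥0∞) (hG : Measurable G) (hw : Measurable w) (s t : ℝ)
    (h : s.HolderConjugate t) (x : E3) :
    ∫⁻ y, G (x - y) * w y ≤ (∫⁻ x, G x ^ s) ^ (1 / s) * (∫⁻ x, w x ^ t) ^ (1 / t) := by
  have mG : Measurable (fun y => G (x - y)) := hG.comp (measurable_const.sub measurable_id)
  have := ENNReal.lintegral_mul_le_Lp_mul_Lq volume h mG.aemeasurable hw.aemeasurable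
  rwa [lintegral_sub_left_eq_self (fun y => G y ^ s) x] at this

/-- The singular kernel `|z|⁻²` cut off to the ball of radius 2. -/
def Ker (z : E3) : ℝ≥0∞ := (ball (0 : E3) 2).indicator (fun z => ENNReal.ofReal (‖z‖ ^ (-2 : ℝ))) z

lemma Ker_meas : Measurable Ker := by
  unfold Ker
  apply Measurable.indicator _ measurableSet_ball
  exact (measurable_norm.pow_const _).ennreal_ofReal

lemma Ker_int (s : ℝ) (hs0 : 0 < s) (hs : s < 3 / 2) : ∫⁻ z, Ker z ^ s < ⊤ := by
  have h1 : IntegrableOn (fun x : E3 => ‖x‖ ^ (-2 * s)) (ball 0 2) := by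
    have := (integrableOn_fun_norm_addHaar (volume : Measure E3) (f := fun y : ℝ => y ^ (-2 * s)) (r := 2))
    rw [this]
    have e : ∀ y ∈ Set.Ioo (0:ℝ) 2, y ^ (2 - 2 * s) = y ^ (Module.finrank ℝ E3 - 1) • y ^ (-2 * s) := by
      intro y hy
      simp only [finrank_euclideanSpace, Fintype.card_fin, smul_eq_mul]
      rw [show (3 - 1 : ℕ) = 2 from rfl, ← Real.rpow_natCast, ← Real.rpow_add hy.1]
      congr 1; push_cast; ring
    refine IntegrableOn.congr_fun ?_ e measurableSet_Ioo
    rw [← integrableOn_Ioc_iff_integrableOn_Ioo, ← intervalIntegrable_iff_integrableOn_Ioc_of_le (by norm_num)]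
    exact intervalIntegral.intervalIntegrable_rpow' (by linarith)
  have e : ∀ z, Ker z ^ s = (ball (0 : E3) 2).indicator (fun z => ENNReal.ofReal (‖z‖ ^ (-2 * s))) z := by
    intro z
    unfold Ker
    by_cases hz : z ∈ ball (0 : E3) 2
    · rw [Set.indicator_of_mem hz, Set.indicator_of_mem hz, ENNReal.ofReal_rpow_of_nonneg (by positivity) hs0.le,
        Real.rpow_mul (norm_nonneg _)]
    · rw [Set.indicator_of_notMem hz, Set.indicator_of_notMem hz, ENNReal.zero_rpow_of_pos hs0]
  simp_rw [e]
  rw [lintegral_indicator measurableSet_ball]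
  exact h1.lintegral_lt_top

/-- `|x|²` -/
def q (x : E3) : ℝ := x 0 * x 0 + x 1 * x 1 + x 2 * x 2

lemma q_eq (x : E3) : q x = ‖x‖ ^ 2 := by
  rw [EuclideanSpace.norm_sq_eq]; simp [q, Fin.sum_univ_three]; ring

lemma q_sm : Sm q := by
  unfold q Sm
  have := sm_coord 0; have := sm_coord 1; have := sm_coord 2
  unfold Sm at *
  fun_prop

lemma pd_q (i : Fin 3) (x : E3) : pd i q x = 2 * x i := by
  have d0 := diff_coord 0
  have d1 := diff_coord 1
  have d2 := diff_coord 2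
  unfold q
  simp (disch := fun_prop) only [pd_add, pd_mul, pd_coord]
  fin_cases i <;> simp <;> ring

lemma pd_comp_q (i : Fin 3) (a : ℝ → ℝ) (x : E3) (ha : DifferentiableAt ℝ a (q x)) :
    pd i (fun y => a (q y)) x = 2 * x i * deriv a (q x) := by
  have h := ha.hasDerivAt.comp_hasFDerivAt x (q_sm.diff x).hasFDerivAt
  have e : (fun y => a (q y)) = a ∘ q := rfl
  rw [pd, e, h.fderiv, ← pd_q]
  simp [pd, mul_comm]

def kd (i j : Fin 3) : ℝ := if i = j then 1 else 0

/-- test field -/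
def Phi (a : ℝ → ℝ) (k j : Fin 3) (x : E3) : ℝ :=
  x k * x j * deriv a (q x) - kd j k * (q x * deriv a (q x) + a (q x))

/-- its gradient -/
def Tk (a1 a2 : ℝ → ℝ) (k i j : Fin 3) (x : E3) : ℝ :=
  kd i k * x j * a1 (q x) + kd i j * x k * a1 (q x) + 2 * x i * x j * x k * a2 (q x)
    - 2 * kd j k * x i * (q x * a2 (q x) + 2 * a1 (q x))

def Psi (a : ℝ → ℝ) (k : Fin 3) (x : E3) : ℝ :=
  x k * (2 * q x * deriv (deriv a) (q x) + 5 * deriv a (q x))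

def Lam (a1 a2 a3 : ℝ → ℝ) (s : ℝ) : ℝ := 4 * s ^ 2 * a3 s + 20 * s * a2 s + 15 * a1 s

abbrev SmR (a : ℝ → ℝ) : Prop := ContDiff ℝ (⊤ : ℕ∞) a

lemma SmR.dd {a : ℝ → ℝ} (h : SmR a) : SmR (deriv a) := by
  have : ContDiff ℝ ((⊤ : ℕ∞) + 1) a := by simpa using h
  exact (contDiff_succ_iff_deriv.1 this).2.2

lemma SmR.cq {a : ℝ → ℝ} (h : SmR a) : Sm (fun x => a (q x)) := h.comp q_sm

lemma pd_cq {a : ℝ → ℝ} (h : SmR a) (i : Fin 3) (x : E3) :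
    pd i (fun y => a (q y)) x = 2 * x i * deriv a (q x) :=
  pd_comp_q i a x (h.differentiable (by simp) _)

lemma Phi_sm {a : ℝ → ℝ} (h : SmR a) (k j : Fin 3) : Sm (Phi a k j) := by
  have h0 := h.cq
  have h1 := h.dd.cq
  have hq := q_sm
  have hk := sm_coord k
  have hj := sm_coord j
  unfold Phi Sm at *
  fun_prop

lemma Psi_sm {a : ℝ → ℝ} (h : SmR a) (k : Fin 3) : Sm (Psi a k) := by
  have h2 := h.dd.dd.cq
  have h1 := h.dd.cq
  have hq := q_sm
  have hk := sm_coord k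
  unfold Psi Sm at *
  fun_prop

lemma pd_Phi {a : ℝ → ℝ} (h : SmR a) (k i j : Fin 3) :
    pd i (Phi a k j) = Tk (deriv a) (deriv (deriv a)) k i j := by
  funext x
  have h0 : Differentiable ℝ a := h.differentiable (by simp)
  have h1 : Differentiable ℝ (deriv a) := h.dd.differentiable (by simp)
  have hq := q_sm.diff
  have hk := diff_coord k
  have hj := diff_coord j
  unfold Phi Tk
  simp (disch := fun_prop) only [pd_sub, pd_add, pd_mul, pd_coord, pd_const, pd_cq h, pd_cq h.dd, pd_q]
  simp only [kd]
  ring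

lemma div_Phi {a : ℝ → ℝ} (h : SmR a) (k : Fin 3) (x : E3) :
    ∑ j, pd j (Phi a k j) x = 0 := by
  simp only [pd_Phi h, Fin.sum_univ_three, Tk, kd, q]
  fin_cases k <;> simp <;> ring

lemma lap_Phi {a : ℝ → ℝ} (h : SmR a) (k j : Fin 3) (x : E3) :
    lap3 (Phi a k j) x = pd j (Psi a k) x
      - kd j k * Lam (deriv a) (deriv (deriv a)) (deriv (deriv (deriv a))) (q x) := by
  have h1 : Differentiable ℝ (deriv a) := h.dd.differentiable (by simp)
  have h2 : Differentiable ℝ (deriv (deriv a)) := h.dd.dd.differentiable (by simp)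
  have hq := q_sm.diff
  have d0 := diff_coord 0
  have d1 := diff_coord 1
  have d2 := diff_coord 2
  have dk := diff_coord k
  have dj := diff_coord j
  simp only [lap3, pd_Phi h, Fin.sum_univ_three]
  unfold Tk Psi Lam
  simp (disch := fun_prop) only [pd_sub, pd_add, pd_mul, pd_coord, pd_const, pd_cq h.dd, pd_cq h.dd.dd, pd_q]
  simp only [kd]
  generalize deriv a (q x) = b1
  generalize deriv (deriv a) (q x) = b2
  generalize deriv (deriv (deriv a)) (q x) = b3
  simp only [q]
  fin_cases k <;> fin_cases j <;> simp <;> ring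

lemma a_zero {a : ℝ → ℝ} {T : ℝ} (h0 : ∀ t, T ≤ t → a t = 0) : ∀ t, T < t → deriv a t = 0 := by
  intro t ht
  have : a =ᶠ[𝓝 t] fun _ => 0 := by
    filter_upwards [lt_mem_nhds ht] with y hy using h0 y hy.le
  rw [this.deriv_eq]; simp

lemma hcs_q {f : E3 → ℝ} (h0 : ∀ x, 4 < q x → f x = 0) : HasCompactSupport f := by
  apply HasCompactSupport.intro (isCompact_closedBall (0 : E3) 2)
  intro x hx
  apply h0
  rw [q_eq]
  simp at hx
  nlinarith

/-- Test the equation against the Oseen-type field. -/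
lemma weak_kernel (u : E3 → E3) (P : E3 → ℝ)
    (hu_meas : Measurable u) (hu : LocallyIntegrable u volume)
    (hweak : IsWeakSolutionNS u P) {a : ℝ → ℝ} (h : SmR a) (h0 : ∀ t, 3 ≤ t → a t = 0) (k : Fin 3) (x : E3) :
    ∫ y, u y k * Lam (deriv a) (deriv (deriv a)) (deriv (deriv (deriv a))) (q (y - x))
      = ∑ i, ∑ j, ∫ y, u y i * u y j * Tk (deriv a) (deriv (deriv a)) k i j (y - x) := by
  have z1 := a_zero h0
  have sm_sub : ∀ f : E3 → ℝ, Sm f → Sm (fun y => f (y - x)) := fun f hf =>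
    hf.comp (contDiff_id.sub contDiff_const)
  have hc_sub : ∀ f : E3 → ℝ, HasCompactSupport f → HasCompactSupport (fun y => f (y - x)) := by
    intro f hf
    exact hf.comp_homeomorph (Homeomorph.subRight x)
  have hPhic : ∀ j, HasCompactSupport (Phi a k j) := fun j => hcs_q (fun y hy => by
    simp [Phi, z1 (q y) (by linarith), h0 (q y) (by linarith)])
  have hz2 : ∀ t, 4 < t → deriv (deriv a) t = 0 := fun t ht =>
    a_zero (T := 3.5) (fun t ht => z1 t (by linarith)) t (by linarith)
  have hPsic : HasCompactSupport (Psi a k) := hcs_q (fun y hy => by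
    simp [Psi, z1 (q y) (by linarith), hz2 (q y) (by linarith)])
  have t1 := hweak.1 (fun y => WithLp.toLp 2 (fun j => Phi a k j (y - x)))
    (by
      rw [contDiff_euclidean]
      intro j
      exact sm_sub _ (Phi_sm h k j))
    (by
      apply HasCompactSupport.intro (isCompact_closedBall x 2)
      intro y hy
      have hq : 4 < q (y - x) := by
        rw [q_eq]; simp [dist_eq_norm] at hy; nlinarith
      ext j
      simp [Phi, z1 (q (y - x)) (by linarith), h0 (q (y - x)) (by linarith)])
  have t2 := hweak.2 (fun y => Psi a k (y - x)) (sm_sub _ (Psi_sm h k)) (hc_sub _ hPsic)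
  have lap_sub : ∀ f : E3 → ℝ, ∀ y, lap3 (fun y => f (y - x)) y = lap3 f (y - x) := by
    intro f y
    unfold lap3
    refine Finset.sum_congr rfl fun i _ => ?_
    have : pd i (fun y => f (y - x)) = fun y => pd i f (y - x) := by funext y; exact pd_comp_sub i f x y
    rw [this, pd_comp_sub]
  have dv : ∀ y, ∑ j, Tk (deriv a) (deriv (deriv a)) k j j y = 0 := by
    intro y
    rw [← div_Phi h k y]
    simp only [pd_Phi h]
  simp only [pd_comp_sub, lap_sub, pd_Phi h] at t1 t2
  simp only [dv, mul_zero, integral_zero, add_zero] at t1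
  have uj : ∀ j, LocallyIntegrable (fun y => u y j) := by
    intro j
    intro x
    obtain ⟨s, hs, hi⟩ := hu x
    exact ⟨s, hs, Integrable.mono hi ((by fun_prop : Measurable fun y => u y j).aestronglyMeasurable)
        (Eventually.of_forall fun y => PiLp.norm_apply_le (u y) j)⟩
  have int1 : ∀ (f : E3 → ℝ) (j : Fin 3), Continuous f → HasCompactSupport f →
      Integrable (fun y => u y j * f (y - x)) := by
    intro f j hf hc
    have := (uj j).integrable_smul_left_of_hasCompactSupport (g := fun y => f (y - x))
      (hf.comp (continuous_id.sub continuous_const)) (hc_sub _ hc)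
    simpa [mul_comm] using this
  have hLs : Sm (fun y => Lam (deriv a) (deriv (deriv a)) (deriv (deriv (deriv a))) (q y)) := by
    have h1 := h.dd.cq
    have h2 := h.dd.dd.cq
    have h3 := h.dd.dd.dd.cq
    have hq := q_sm
    unfold Lam Sm at *
    fun_prop
  have hLc : HasCompactSupport (fun y => Lam (deriv a) (deriv (deriv a)) (deriv (deriv (deriv a))) (q y)) := by
    apply hcs_q
    intro y hy
    have := a_zero (T := 3.7) (a := deriv (deriv a)) (fun t ht => a_zero (T := 3.5) (fun t ht => z1 t (by linarith)) t (by linarith)) (q y) (by linarith)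
    simp [Lam, z1 (q y) (by linarith), hz2 (q y) hy, this]
  have e1 : ∫ y, ∑ j, u y j * lap3 (Phi a k j) (y - x) =
      ∫ y, ((∑ j, u y j * pd j (Psi a k) (y - x)) -
        u y k * Lam (deriv a) (deriv (deriv a)) (deriv (deriv (deriv a))) (q (y - x))) := by
    congr 1; funext y
    simp only [lap_Phi h, kd, mul_sub, Finset.sum_sub_distrib]
    simp
  rw [e1, integral_sub, t2] at t1
  · linarith
  · exact integrable_finsetSum _ fun j _ => int1 _ j ((Psi_sm h k).dpd j).continuous (pd_hcs hPsic j)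
  · exact int1 _ k hLs.continuous hLc

def chi (s : ℝ) : ℝ := Real.smoothTransition (2 - s)

lemma chi_sm : SmR chi := by
  unfold chi SmR
  exact Real.smoothTransition.contDiff.comp (contDiff_const.sub contDiff_id)

lemma chi_one {s : ℝ} (h : s ≤ 1) : chi s = 1 := Real.smoothTransition.one_of_one_le (by linarith)
lemma chi_zero {s : ℝ} (h : 2 ≤ s) : chi s = 0 := Real.smoothTransition.zero_of_nonpos (by linarith)

/-- the profile `s^{-1/2} χ(s)` -/
def Apr (s : ℝ) : ℝ := (√s)⁻¹ * chi s

lemma Apr_sm : ContDiffOn ℝ (⊤ : ℕ∞) Apr (Set.Ioi 0) := by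
  unfold Apr
  apply ContDiffOn.mul _ chi_sm.contDiffOn
  apply ContDiffOn.inv
  · exact fun x hx => (Real.contDiffAt_sqrt (ne_of_gt hx)).contDiffWithinAt
  · intro x hx
    exact (Real.sqrt_pos.2 hx).ne'

lemma deriv_smOn {f : ℝ → ℝ} (h : ContDiffOn ℝ (⊤ : ℕ∞) f (Set.Ioi 0)) :
    ContDiffOn ℝ (⊤ : ℕ∞) (deriv f) (Set.Ioi 0) := by
  exact h.deriv_of_isOpen isOpen_Ioi (by simp)

abbrev A1 : ℝ → ℝ := deriv Apr
abbrev A2 : ℝ → ℝ := deriv A1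
abbrev A3 : ℝ → ℝ := deriv A2

lemma A1_sm : ContDiffOn ℝ (⊤ : ℕ∞) A1 (Set.Ioi 0) := deriv_smOn Apr_sm
lemma A2_sm : ContDiffOn ℝ (⊤ : ℕ∞) A2 (Set.Ioi 0) := deriv_smOn A1_sm
lemma A3_sm : ContDiffOn ℝ (⊤ : ℕ∞) A3 (Set.Ioi 0) := deriv_smOn A2_sm

lemma dAt {f : ℝ → ℝ} (h : ContDiffOn ℝ (⊤ : ℕ∞) f (Set.Ioi 0)) {s : ℝ} (hs : 0 < s) :
    DifferentiableAt ℝ f s :=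
  (h.differentiableOn (by simp)).differentiableAt (Ioi_mem_nhds hs)

lemma deriv_congr_Ioo {f g : ℝ → ℝ} {c d : ℝ} (h : ∀ s, c < s → s < d → f s = g s) :
    ∀ s, c < s → s < d → deriv f s = deriv g s := by
  intro s h1 h2
  apply EventuallyEq.deriv_eq
  filter_upwards [Ioo_mem_nhds h1 h2] with y hy using h y hy.1 hy.2

lemma deriv_rp (c p : ℝ) (s : ℝ) (hs : 0 < s) : deriv (fun s : ℝ => c * s ^ p) s = c * p * s ^ (p - 1) := by
  rw [deriv_const_mul _ (Real.differentiableAt_rpow_const_of_ne p hs.ne'), Real.deriv_rpow_const]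
  ring

lemma Apr_small : ∀ s, 0 < s → s < 1 → Apr s = 1 * s ^ (-1 / 2 : ℝ) := by
  intro s h1 h2
  rw [Apr, chi_one h2.le, mul_one, one_mul, Real.sqrt_eq_rpow, ← Real.rpow_neg h1.le]; norm_num

lemma A1_small : ∀ s, 0 < s → s < 1 → A1 s = (-1 / 2) * s ^ (-3 / 2 : ℝ) := by
  intro s h1 h2
  rw [A1, deriv_congr_Ioo Apr_small s h1 h2, deriv_rp _ _ _ h1]; norm_num

lemma A2_small : ∀ s, 0 < s → s < 1 → A2 s = (3 / 4) * s ^ (-5 / 2 : ℝ) := by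
  intro s h1 h2
  rw [A2, deriv_congr_Ioo A1_small s h1 h2, deriv_rp _ _ _ h1]; norm_num

lemma A3_small : ∀ s, 0 < s → s < 1 → A3 s = (-15 / 8) * s ^ (-7 / 2 : ℝ) := by
  intro s h1 h2
  rw [A3, deriv_congr_Ioo A2_small s h1 h2, deriv_rp _ _ _ h1]; norm_num

lemma Apr_large : ∀ s, 2 ≤ s → Apr s = 0 := by
  intro s h; simp [Apr, chi_zero h]

lemma A1_large' : ∀ s, 2 < s → A1 s = 0 := a_zero Apr_large
lemma A2_large' : ∀ s, 2 < s → A2 s = 0 := by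
  intro s hs
  exact a_zero (T := (2 + s) / 2) (fun t ht => A1_large' t (by linarith)) s (by linarith)
lemma A3_large' : ∀ s, 2 < s → A3 s = 0 := by
  intro s hs
  exact a_zero (T := (2 + s) / 2) (fun t ht => A2_large' t (by linarith)) s (by linarith)

lemma sq_rp {r : ℝ} (hr : 0 < r) (n : ℕ) : r ^ n * (r ^ 2) ^ (-(n:ℝ) / 2 : ℝ) = 1 := by
  rw [← Real.rpow_natCast, ← Real.rpow_natCast, ← Real.rpow_mul hr.le, ← Real.rpow_add hr]
  have : (n : ℝ) + ((2:ℕ):ℝ) * (-(n:ℝ) / 2) = 0 := by push_cast; ring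
  rw [this, Real.rpow_zero]

/-- rescaled profile functions are bounded -/
lemma bdd_aux {f : ℝ → ℝ} (n : ℕ) (c : ℝ) (hf : ContDiffOn ℝ (⊤ : ℕ∞) f (Set.Ioi 0))
    (hs : ∀ s, 0 < s → s < 1 → f s = c * s ^ (-(n:ℝ) / 2 : ℝ)) (hl : ∀ s, 2 < s → f s = 0) :
    ∃ C, 0 ≤ C ∧ ∀ r, 0 < r → |r ^ n * f (r ^ 2)| ≤ C := by
  have hc : ContinuousOn (fun r : ℝ => r ^ n * f (r ^ 2)) (Set.Icc (1/2) 2) := by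
    apply ContinuousOn.mul (by fun_prop)
    apply hf.continuousOn.comp (by fun_prop)
    intro r hr
    have := hr.1
    have h0 : 0 < r := by linarith
    exact Set.mem_Ioi.2 (by positivity)
  obtain ⟨C, hC⟩ := isCompact_Icc.exists_bound_of_continuousOn hc
  refine ⟨max (max C |c|) 0, le_max_right _ _, fun r hr => ?_⟩
  by_cases h1 : r < 1 / 2
  · have : r ^ 2 < 1 := by nlinarith
    rw [hs _ (by positivity) this]
    have e : r ^ n * (c * (r ^ 2) ^ (-(n:ℝ) / 2 : ℝ)) = c := by
      rw [mul_left_comm, sq_rp hr, mul_one]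
    rw [e]; exact le_max_of_le_left (le_max_right _ _)
  by_cases h2 : 2 < r
  · rw [hl _ (by nlinarith)]; simp
  · exact le_max_of_le_left (le_max_of_le_left (hC r ⟨by linarith, by linarith⟩))

lemma A1_bdd : ∃ C, 0 ≤ C ∧ ∀ r, 0 < r → |r ^ 3 * A1 (r ^ 2)| ≤ C := 
  bdd_aux 3 (-1 / 2) A1_sm (by simpa using A1_small) A1_large'
lemma A2_bdd : ∃ C, 0 ≤ C ∧ ∀ r, 0 < r → |r ^ 5 * A2 (r ^ 2)| ≤ C := 
  bdd_aux 5 (3 / 4) A2_sm (by simpa using A2_small) A2_large'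

def SigL (s : ℝ) : ℝ := Lam A1 A2 A3 s

lemma SigL_small : ∀ s, 0 < s → s < 1 → SigL s = 0 := by
  intro s h1 h2
  rw [SigL, Lam, A1_small s h1 h2, A2_small s h1 h2, A3_small s h1 h2]
  have e1 : s ^ (-3 / 2 : ℝ) = s ^ 2 * s ^ (-7 / 2 : ℝ) := by
    rw [← Real.rpow_natCast s 2, ← Real.rpow_add h1]; norm_num
  have e2 : s ^ (-5 / 2 : ℝ) = s * s ^ (-7 / 2 : ℝ) := by
    nth_rewrite 2 [← Real.rpow_one s]
    rw [← Real.rpow_add h1]; norm_num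
  rw [e1, e2]; ring

def Sig (s : ℝ) : ℝ := if s ≤ 1 / 2 then 0 else SigL s

lemma Sig_pos {s : ℝ} (hs : 0 < s) : Sig s = SigL s := by
  unfold Sig
  split_ifs with h
  · rw [SigL_small s hs (by linarith)]
  · rfl

lemma Sig_small {s : ℝ} (hs : s < 1) : Sig s = 0 := by
  unfold Sig
  split_ifs with h
  · rfl
  · exact SigL_small s (by linarith) hs

lemma Sig_large {s : ℝ} (hs : 2 < s) : Sig s = 0 := by
  rw [Sig_pos (by linarith), SigL, Lam, A1_large' s hs, A2_large' s hs, A3_large' s hs]; ring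

lemma Sig_cont : Continuous Sig := by
  rw [continuous_iff_continuousAt]
  intro s
  by_cases h : s < 1
  · have : Sig =ᶠ[𝓝 s] fun _ => 0 := by
      filter_upwards [gt_mem_nhds h] with y hy using Sig_small hy
    exact continuousAt_const.congr this.symm
  · have hs : 0 < s := by linarith
    have : Sig =ᶠ[𝓝 s] SigL := by
      filter_upwards [lt_mem_nhds hs] with y hy using Sig_pos hy
    refine ContinuousAt.congr ?_ this.symm
    have c1 := A1_sm.continuousOn.continuousAt (Ioi_mem_nhds hs)
    have c2 := A2_sm.continuousOn.continuousAt (Ioi_mem_nhds hs)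
    have c3 := A3_sm.continuousOn.continuousAt (Ioi_mem_nhds hs)
    unfold SigL Lam
    fun_prop

lemma Sig_bdd : ∃ C, 0 ≤ C ∧ ∀ s, |Sig s| ≤ C := by
  have hc : HasCompactSupport Sig := by
    apply HasCompactSupport.intro (isCompact_Icc (a := (1:ℝ)) (b := 2))
    intro x hx
    by_cases h : x < 1
    · exact Sig_small h
    · apply Sig_large
      by_contra h2
      exact hx ⟨by linarith, by linarith⟩
  obtain ⟨C, hC⟩ := Sig_cont.bounded_above_of_compact_support hc
  exact ⟨C, (norm_nonneg _).trans (hC 0), hC⟩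

/-- truncated profile -/
def aN (N : ℝ) (s : ℝ) : ℝ := Apr s - N * Apr (N ^ 2 * s)

lemma aN_small {N : ℝ} (hN : 1 ≤ N) {s : ℝ} (hs : s ≤ 1 / N ^ 2) : aN N s = 0 := by
  have hN0 : 0 < N := by linarith
  have h1 : N ^ 2 * s ≤ 1 := by
    rw [le_div_iff₀ (by positivity)] at hs; linarith
  have h2 : s ≤ 1 := hs.trans (by rw [div_le_one (by positivity)]; nlinarith)
  rw [aN, Apr, Apr, chi_one h1, chi_one h2, Real.sqrt_mul (by positivity), Real.sqrt_sq hN0.le, mul_inv]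
  field_simp
  simp

lemma aN_sm {N : ℝ} (hN : 1 ≤ N) : SmR (aN N) := by
  have hN0 : 0 < N := by linarith
  rw [SmR, contDiff_iff_contDiffAt]
  intro s
  by_cases h : s < 1 / N ^ 2
  · have : aN N =ᶠ[𝓝 s] fun _ => 0 := by
      filter_upwards [gt_mem_nhds h] with y hy using aN_small hN hy.le
    exact contDiffAt_const.congr_of_eventuallyEq this
  · have hs : 0 < s := lt_of_lt_of_le (by positivity) (not_lt.1 h)
    unfold aN
    apply ContDiffAt.sub
    · exact Apr_sm.contDiffAt (Ioi_mem_nhds hs)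
    · apply ContDiffAt.mul contDiffAt_const
      have h1 : ContDiffAt ℝ (⊤ : ℕ∞) Apr (N ^ 2 * s) := Apr_sm.contDiffAt (Ioi_mem_nhds (by positivity))
      exact h1.comp s (contDiffAt_const.mul contDiffAt_id)

lemma aN_large {N : ℝ} (hN : 1 ≤ N) : ∀ s, 3 ≤ s → aN N s = 0 := by
  intro s hs
  rw [aN, Apr_large s (by linarith), Apr_large (N ^ 2 * s) (by nlinarith)]; ring

lemma scale_deriv {f g : ℝ → ℝ} {c M : ℝ} (hM : 0 < M) (hf : ContDiffOn ℝ (⊤ : ℕ∞) f (Set.Ioi 0))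
    (h : ∀ s, 0 < s → g s = f s - c * f (M * s)) :
    ∀ s, 0 < s → deriv g s = deriv f s - (c * M) * deriv f (M * s) := by
  intro s hs
  have e : g =ᶠ[𝓝 s] fun s => f s - c * f (M * s) := by
    filter_upwards [lt_mem_nhds hs] with y hy using h y hy
  rw [e.deriv_eq]
  have d1 := (dAt hf hs).hasDerivAt
  have d2 := (dAt hf (mul_pos hM hs)).hasDerivAt
  have d3 : HasDerivAt (fun s => f (M * s)) (deriv f (M * s) * M) s := by
    exact HasDerivAt.comp s d2 (by simpa using (hasDerivAt_id s).const_mul M)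
  have d4 : HasDerivAt (fun s => f s - c * f (M * s)) _ s := d1.sub (d3.const_mul c)
  rw [d4.deriv]; ring

lemma aN_d1 {N : ℝ} (hN : 1 ≤ N) : ∀ s, 0 < s → deriv (aN N) s = A1 s - (N * N ^ 2) * A1 (N ^ 2 * s) :=
  scale_deriv (by positivity) Apr_sm (fun _ _ => rfl)
lemma aN_d2 {N : ℝ} (hN : 1 ≤ N) : ∀ s, 0 < s → deriv (deriv (aN N)) s = A2 s - (N * N ^ 2 * N ^ 2) * A2 (N ^ 2 * s) :=
  scale_deriv (by positivity) A1_sm (aN_d1 hN)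
lemma aN_d3 {N : ℝ} (hN : 1 ≤ N) : ∀ s, 0 < s → deriv (deriv (deriv (aN N))) s = A3 s - (N * N ^ 2 * N ^ 2 * N ^ 2) * A3 (N ^ 2 * s) :=
  scale_deriv (by positivity) A2_sm (aN_d2 hN)

lemma Lam_aN {N : ℝ} (hN : 1 ≤ N) (s : ℝ) :
    Lam (deriv (aN N)) (deriv (deriv (aN N))) (deriv (deriv (deriv (aN N)))) s = Sig s - N ^ 3 * Sig (N ^ 2 * s) := by
  have hN0 : 0 < N := by linarith
  by_cases hs : 0 < s
  · rw [Sig_pos hs, Sig_pos (by positivity), Lam, aN_d1 hN s hs, aN_d2 hN s hs, aN_d3 hN s hs, SigL, SigL, Lam, Lam]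
    ring
  · have hs' : s ≤ 0 := not_lt.1 hs
    have hpos : 0 < 1 / N ^ 2 := by positivity
    have e0 : ∀ t, (s - 1) < t → t < 1 / N ^ 2 → aN N t = (fun _ => (0:ℝ)) t := fun t _ ht => aN_small hN ht.le
    have e1 : ∀ t, (s - 1) < t → t < 1 / N ^ 2 → deriv (aN N) t = (fun _ => (0:ℝ)) t := fun t h1 h2 => by
      rw [deriv_congr_Ioo e0 t h1 h2]; simp
    have e2 : ∀ t, (s - 1) < t → t < 1 / N ^ 2 → deriv (deriv (aN N)) t = (fun _ => (0:ℝ)) t := fun t h1 h2 => by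
      rw [deriv_congr_Ioo e1 t h1 h2]; simp
    have e3 : ∀ t, (s - 1) < t → t < 1 / N ^ 2 → deriv (deriv (deriv (aN N))) t = (fun _ => (0:ℝ)) t := fun t h1 h2 => by
      rw [deriv_congr_Ioo e2 t h1 h2]; simp
    rw [Lam, e1 s (by linarith) (by linarith), e2 s (by linarith) (by linarith), e3 s (by linarith) (by linarith),
      Sig_small (by linarith), Sig_small]
    · simp
    · nlinarith [sq_nonneg N]

lemma Tk_bound : ∃ C : ℝ, 0 ≤ C ∧ ∀ N : ℝ, 1 ≤ N → ∀ (k i j : Fin 3) (z : E3),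
    ENNReal.ofReal |Tk (deriv (aN N)) (deriv (deriv (aN N))) k i j z| ≤ ENNReal.ofReal C * Ker z := by
  obtain ⟨C1, hC1, b1⟩ := A1_bdd
  obtain ⟨C2, hC2, b2⟩ := A2_bdd
  refine ⟨12 * C1 + 8 * C2, by positivity, fun N hN k i j z => ?_⟩
  have hN0 : 0 < N := by linarith
  by_cases hz : z = 0
  · subst hz; simp [Tk]
  have hr : 0 < ‖z‖ := norm_pos_iff.2 hz
  set r := ‖z‖ with hrdef
  have hzi : ∀ i, |z i| ≤ r := fun i => PiLp.norm_apply_le z i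
  have hq : q z = r ^ 2 := q_eq z
  by_cases hr2 : r < 2
  · have hK : Ker z = ENNReal.ofReal (r ^ (-2 : ℝ)) := by
      rw [Ker, Set.indicator_of_mem (by simpa using hr2)]
    rw [hK, ← ENNReal.ofReal_mul (by positivity)]
    apply ENNReal.ofReal_le_ofReal
    have ek : ∀ i j, |kd i j| ≤ 1 := by intro i j; unfold kd; split_ifs <;> simp
    have B1 : r ^ 3 * |deriv (aN N) (r ^ 2)| ≤ 2 * C1 := by
      rw [aN_d1 hN _ (by positivity)]
      have t1 := b1 r hr
      have t2 := b1 (N * r) (by positivity)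
      have : r ^ 3 * |A1 (r ^ 2) - N * N ^ 2 * A1 (N ^ 2 * r ^ 2)| = |r ^ 3 * A1 (r ^ 2) - (N * r) ^ 3 * A1 ((N * r) ^ 2)| := by
        rw [← abs_of_pos (show 0 < r ^ 3 by positivity), ← abs_mul, abs_of_pos (show 0 < r ^ 3 by positivity)]
        congr 1; rw [mul_pow N r 2]; ring
      rw [this]
      exact (abs_sub _ _).trans (by linarith)
    have B2 : r ^ 5 * |deriv (deriv (aN N)) (r ^ 2)| ≤ 2 * C2 := by
      rw [aN_d2 hN _ (by positivity)]
      have t1 := b2 r hr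
      have t2 := b2 (N * r) (by positivity)
      have : r ^ 5 * |A2 (r ^ 2) - N * N ^ 2 * N ^ 2 * A2 (N ^ 2 * r ^ 2)| = |r ^ 5 * A2 (r ^ 2) - (N * r) ^ 5 * A2 ((N * r) ^ 2)| := by
        rw [← abs_of_pos (show 0 < r ^ 5 by positivity), ← abs_mul, abs_of_pos (show 0 < r ^ 5 by positivity)]
        congr 1; rw [mul_pow N r 2]; ring
      rw [this]
      exact (abs_sub _ _).trans (by linarith)
    rw [Tk, hq]
    set x1 := deriv (aN N) (r ^ 2)
    set x2 := deriv (deriv (aN N)) (r ^ 2)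
    have m1 : |kd i k * z j * x1| ≤ r * |x1| := by
      rw [abs_mul, abs_mul]
      exact mul_le_mul_of_nonneg_right (by nlinarith [ek i k, hzi j, abs_nonneg (z j), abs_nonneg (kd i k)]) (abs_nonneg _)
    have m2 : |kd i j * z k * x1| ≤ r * |x1| := by
      rw [abs_mul, abs_mul]
      exact mul_le_mul_of_nonneg_right (by nlinarith [ek i j, hzi k, abs_nonneg (z k), abs_nonneg (kd i j)]) (abs_nonneg _)
    have m3 : |2 * z i * z j * z k * x2| ≤ 2 * r ^ 3 * |x2| := by
      rw [abs_mul, abs_mul, abs_mul, abs_mul]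
      apply mul_le_mul_of_nonneg_right _ (abs_nonneg _)
      calc |(2:ℝ)| * |z i| * |z j| * |z k| ≤ 2 * r * r * r := by
            rw [abs_two]; gcongr <;> apply hzi
        _ = 2 * r ^ 3 := by ring
    have m4 : |2 * kd j k * z i * (r ^ 2 * x2 + 2 * x1)| ≤ 2 * r * (r ^ 2 * |x2| + 2 * |x1|) := by
      rw [abs_mul, abs_mul, abs_mul]
      have : |r ^ 2 * x2 + 2 * x1| ≤ r ^ 2 * |x2| + 2 * |x1| := by
        refine (abs_add_le _ _).trans (le_of_eq ?_)
        rw [abs_mul, abs_mul, abs_two, abs_of_pos (show 0 < r ^ 2 by positivity)]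
      have h2 : |(2:ℝ)| * |kd j k| * |z i| ≤ 2 * 1 * r := by
        rw [abs_two]; gcongr; exacts [ek j k, hzi i]
      calc _ ≤ (2 * 1 * r) * (r ^ 2 * |x2| + 2 * |x1|) := by gcongr
        _ = _ := by ring
    have tot : |kd i k * z j * x1 + kd i j * z k * x1 + 2 * z i * z j * z k * x2 - 2 * kd j k * z i * (r ^ 2 * x2 + 2 * x1)|
        ≤ 6 * (r * |x1|) + 4 * (r ^ 3 * |x2|) := by
      refine (abs_sub _ _).trans ?_
      have := abs_add_three (kd i k * z j * x1) (kd i j * z k * x1) (2 * z i * z j * z k * x2)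
      nlinarith
    refine tot.trans ?_
    have e : r ^ (-2 : ℝ) = (r ^ 2)⁻¹ := by rw [Real.rpow_neg hr.le]; norm_num
    rw [e, ← div_eq_mul_inv, le_div_iff₀ (by positivity)]
    nlinarith
  · have hq2 : 3 < q z := by rw [hq]; nlinarith
    have z1 := a_zero (aN_large hN) (q z) hq2
    have z2 := a_zero (T := 3.5) (fun t ht => a_zero (aN_large hN) t (by linarith)) (q z) (by rw [hq]; nlinarith)
    simp [Tk, z1, z2]

def Wp (r : ℝ) : ℝ := 2 * (r ^ 5 * A2 (r ^ 2)) + 5 * (r ^ 3 * A1 (r ^ 2))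

lemma Wp_small {r : ℝ} (h0 : 0 < r) (h1 : r < 1) : Wp r = -1 := by
  have h2 : r ^ 2 < 1 := by nlinarith
  have e5 := sq_rp h0 5
  have e3 := sq_rp h0 3
  norm_num at e5 e3
  rw [Wp, A1_small _ (by positivity) h2, A2_small _ (by positivity) h2]
  norm_num
  linear_combination (3/2) * e5 - (5/2) * e3

lemma Wp_deriv {r : ℝ} (h0 : 0 < r) : HasDerivAt Wp (r ^ 2 * Sig (r ^ 2)) r := by
  have hr2 : 0 < r ^ 2 := by positivity
  rw [Sig_pos hr2]
  have d1 : HasDerivAt A1 (A2 (r ^ 2)) (r ^ 2) := (dAt A1_sm hr2).hasDerivAt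
  have d2 : HasDerivAt A2 (A3 (r ^ 2)) (r ^ 2) := (dAt A2_sm hr2).hasDerivAt
  have p2 : HasDerivAt (fun r : ℝ => r ^ 2) (2 * r) r := by simpa using hasDerivAt_pow 2 r
  have p3 : HasDerivAt (fun r : ℝ => r ^ 3) (3 * r ^ 2) r := by simpa using hasDerivAt_pow 3 r
  have p5 : HasDerivAt (fun r : ℝ => r ^ 5) (5 * r ^ 4) r := by simpa using hasDerivAt_pow 5 r
  have c1 : HasDerivAt (fun r : ℝ => A1 (r ^ 2)) (A2 (r ^ 2) * (2 * r)) r :=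
    HasDerivAt.comp (h₂ := A1) (h := fun r : ℝ => r ^ 2) r d1 p2
  have c2 : HasDerivAt (fun r : ℝ => A2 (r ^ 2)) (A3 (r ^ 2) * (2 * r)) r :=
    HasDerivAt.comp (h₂ := A2) (h := fun r : ℝ => r ^ 2) r d2 p2
  have := ((p5.mul c2).const_mul 2).add ((p3.mul c1).const_mul 5)
  refine HasDerivAt.congr_deriv (f := Wp) this ?_
  rw [SigL, Lam]; ring

def Wt (r : ℝ) : ℝ := if r ≤ 1 / 2 then -1 else Wp r

lemma Wt_deriv {r : ℝ} (h0 : 0 ≤ r) : HasDerivAt Wt (r ^ 2 * Sig (r ^ 2)) r := by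
  by_cases h1 : r < 1
  · have e : Wt =ᶠ[𝓝 r] fun _ => -1 := by
      filter_upwards [gt_mem_nhds h1] with y hy
      unfold Wt; split_ifs with h
      · rfl
      · exact Wp_small (by linarith) hy
    rw [Sig_small (by nlinarith), mul_zero]
    exact (hasDerivAt_const r (-1 : ℝ)).congr_of_eventuallyEq e
  · have e : Wt =ᶠ[𝓝 r] Wp := by
      filter_upwards [lt_mem_nhds (show 1 / 2 < r by linarith)] with y hy
      unfold Wt; rw [if_neg (by linarith)]
    exact (Wp_deriv (by linarith)).congr_of_eventuallyEq e

lemma int_W : ∫ r in Set.Ioi (0:ℝ), r ^ 2 * Sig (r ^ 2) = 1 := by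
  have hc : Continuous (fun r : ℝ => r ^ 2 * Sig (r ^ 2)) := by
    have := Sig_cont
    fun_prop
  have hs : HasCompactSupport (fun r : ℝ => r ^ 2 * Sig (r ^ 2)) := by
    apply HasCompactSupport.intro (isCompact_Icc (a := (-2:ℝ)) (b := 2))
    intro x hx
    rw [Sig_large, mul_zero]
    by_contra h
    exact hx ⟨by nlinarith, by nlinarith⟩
  rw [integral_Ioi_of_hasDerivAt_of_tendsto' (f := Wt) (m := 0) (fun x hx => Wt_deriv hx)
    (hc.integrable_of_hasCompactSupport hs).integrableOn]
  · simp [Wt]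
  · apply tendsto_const_nhds.congr'
    filter_upwards [eventually_gt_atTop 2] with r hr
    rw [Wt, if_neg (by linarith), Wp, A1_large' _ (by nlinarith), A2_large' _ (by nlinarith)]
    simp

def cS : ℝ := ∫ z : E3, Sig (q z)

lemma cS_pos : 0 < cS := by
  have h := integral_fun_norm_addHaar (volume : Measure E3) (fun r => Sig (r ^ 2))
  simp only [finrank_euclideanSpace, Fintype.card_fin, smul_eq_mul, show 3 - 1 = 2 from rfl, int_W] at h
  rw [cS]
  simp only [q_eq]
  rw [h]
  have : 0 < (volume : Measure E3).real (ball 0 1) := by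
    rw [Measure.real, ENNReal.toReal_pos_iff]
    exact ⟨measure_ball_pos _ _ one_pos, measure_ball_lt_top⟩
  simpa using this

lemma Sq_cont : Continuous (fun z : E3 => Sig (q z)) := Sig_cont.comp q_sm.continuous

lemma q_smul (N : ℝ) (z : E3) : q (N • z) = N ^ 2 * q z := by simp [q]; ring

lemma int_scaled {N : ℝ} (hN : 0 < N) (x : E3) : ∫ y, N ^ 3 * Sig (N ^ 2 * q (y - x)) = cS := by
  rw [integral_const_mul, integral_sub_right_eq_self (fun y => Sig (N ^ 2 * q y)) x]
  simp only [← q_smul]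
  rw [Measure.integral_comp_smul (volume : Measure E3) (fun z => Sig (q z)) N]
  simp only [finrank_euclideanSpace, Fintype.card_fin, smul_eq_mul]
  rw [abs_of_pos (by positivity)]
  unfold cS
  field_simp

lemma ae_lim (f : E3 → ℝ) (hf : LocallyIntegrable f volume) : ∀ᵐ x : E3,
    Tendsto (fun n : ℕ => ∫ y, ((n:ℝ) + 1) ^ 3 * Sig (((n:ℝ) + 1) ^ 2 * q (y - x)) * f y) atTop (𝓝 (cS * f x)) := by
  obtain ⟨C, hC0, hC⟩ := Sig_bdd
  filter_upwards [(Besicovitch.vitaliFamily (volume : Measure E3)).ae_tendsto_average_norm_sub hf] with x h₀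
  have hδ : Tendsto (fun n : ℕ => 2 / ((n:ℝ) + 1)) atTop (𝓝[>] 0) := by
    refine tendsto_nhdsWithin_iff.2 ⟨?_, Eventually.of_forall (fun i ↦ Set.mem_Ioi.2 (by positivity))⟩
    have := (tendsto_one_div_add_atTop_nhds_zero_nat (𝕜 := ℝ)).const_mul 2
    simpa [div_eq_mul_inv] using this
  have h1 := (h₀.comp (Besicovitch.tendsto_filterAt volume x)).comp hδ
  have key := tendsto_integral_smul_of_tendsto_average_norm_sub
    (g := fun (n : ℕ) y => cS⁻¹ * (((n:ℝ) + 1) ^ 3 * Sig (((n:ℝ) + 1) ^ 2 * q (y - x))))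
    (cS⁻¹ * C * 8 * (volume : Measure E3).real (ball 0 1)) h1 ?_ ?_ ?_ ?_
  · have := key.const_mul cS
    refine this.congr (fun n => ?_)
    rw [← integral_const_mul]
    congr 1; funext y
    have := cS_pos.ne'
    simp only [smul_eq_mul]
    field_simp
  · filter_upwards with n using hf.integrableOn_isCompact (isCompact_closedBall _ _)
  · apply tendsto_const_nhds.congr (fun n => ?_)
    rw [integral_const_mul, int_scaled (by positivity), inv_mul_cancel₀ cS_pos.ne']
  · filter_upwards with n
    intro y hy
    by_contra h
    apply hy
    have hn : (0:ℝ) < n + 1 := by positivity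
    show cS⁻¹ * (((n:ℝ) + 1) ^ 3 * Sig (((n:ℝ) + 1) ^ 2 * q (y - x))) = 0
    rw [Sig_large]
    · simp
    · have h2 : 2 / ((n:ℝ) + 1) < ‖y - x‖ := by simpa [dist_eq_norm] using h
      rw [div_lt_iff₀ hn] at h2
      rw [q_eq, ← mul_pow]
      nlinarith
  · filter_upwards with n y
    have hn : (0:ℝ) < n + 1 := by positivity
    have hv : 0 < (volume : Measure E3).real (ball 0 1) := by
      rw [Measure.real, ENNReal.toReal_pos_iff]
      exact ⟨measure_ball_pos _ _ one_pos, measure_ball_lt_top⟩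
    rw [Measure.addHaar_real_closedBall _ _ (by positivity)]
    simp only [finrank_euclideanSpace, Fintype.card_fin]
    rw [abs_mul, abs_mul, abs_of_pos (inv_pos.2 cS_pos), abs_of_pos (by positivity : (0:ℝ) < ((n:ℝ) + 1) ^ 3)]
    have := hC (((n:ℝ) + 1) ^ 2 * q (y - x))
    have hc := cS_pos
    calc cS⁻¹ * (((n:ℝ) + 1) ^ 3 * |Sig (((n:ℝ) + 1) ^ 2 * q (y - x))|) ≤ cS⁻¹ * (((n:ℝ) + 1) ^ 3 * C) := by gcongr
      _ = _ := by field_simp; norm_num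

/-- pointwise inequality driving the bootstrap -/
lemma ptwise (u : E3 → E3) (P : E3 → ℝ)
    (hu_meas : Measurable u) (hu : LocallyIntegrable u volume)
    (hweak : IsWeakSolutionNS u P) :
    ∃ C : ℝ≥0∞, C ≠ ⊤ ∧ ∀ᵐ x : E3, ‖u x‖ₑ ≤ C * ((∫⁻ y in ball x 2, ‖u y‖ₑ) + ∫⁻ y, Ker (x - y) * ‖u y‖ₑ ^ 2) := by
  obtain ⟨CT, hCT0, hT⟩ := Tk_bound
  obtain ⟨C, hC0, hC⟩ := Sig_bdd
  have uj : ∀ j, LocallyIntegrable (fun y => u y j) := by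
    intro j x
    obtain ⟨s, hs, hi⟩ := hu x
    exact ⟨s, hs, Integrable.mono hi ((by fun_prop : Measurable fun y => u y j).aestronglyMeasurable)
        (Eventually.of_forall fun y => PiLp.norm_apply_le (u y) j)⟩
  have hcomp : ∀ (i : Fin 3) y, ‖u y i‖ₑ ≤ ‖u y‖ₑ := fun i y => by
    rw [enorm_le_iff_norm_le]; exact PiLp.norm_apply_le (u y) i
  have Ker_neg : ∀ z, Ker (-z) = Ker z := by
    intro z; unfold Ker
    simp [Set.indicator]
  have hintg : ∀ (x : E3) (k : Fin 3) (g : ℝ → ℝ), Continuous g → (∀ s, 2 < s → g s = 0) →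
      Integrable (fun y => u y k * g (q (y - x))) := by
    intro x k g hg h0
    have := (uj k).integrable_smul_left_of_hasCompactSupport (g := fun y => g (q (y - x)))
      (hg.comp (q_sm.continuous.comp (continuous_id.sub continuous_const))) (by
        apply HasCompactSupport.intro (isCompact_closedBall x 2)
        intro y hy
        apply h0
        rw [q_eq]; simp [dist_eq_norm] at hy; nlinarith)
    simpa [mul_comm] using this
  set D : E3 → ℝ≥0∞ := fun x => ENNReal.ofReal C * (∫⁻ y in ball x 2, ‖u y‖ₑ) + 9 * ENNReal.ofReal CT * ∫⁻ y, Ker (x - y) * ‖u y‖ₑ ^ 2 with hD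
  have step : ∀ (k : Fin 3) (x : E3) (N : ℝ), 1 ≤ N → ‖∫ y, N ^ 3 * Sig (N ^ 2 * q (y - x)) * u y k‖ₑ ≤ D x := by
    intro k x N hN
    have w := weak_kernel u P hu_meas hu hweak (aN_sm hN) (aN_large hN) k x
    simp only [Lam_aN hN, mul_sub] at w
    have cSg := Sig_cont
    rw [integral_sub (hintg x k Sig Sig_cont (fun s hs => Sig_large hs))
      (hintg x k (fun s => N ^ 3 * Sig (N ^ 2 * s)) (by fun_prop) (fun s hs => by
        rw [Sig_large (by nlinarith [one_le_pow₀ hN (n := 2)]), mul_zero]))] at w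
    have e : ∫ y, N ^ 3 * Sig (N ^ 2 * q (y - x)) * u y k = (∫ y, u y k * Sig (q (y - x))) -
        ∑ i, ∑ j, ∫ y, u y i * u y j * Tk (deriv (aN N)) (deriv (deriv (aN N))) k i j (y - x) := by
      rw [← w]
      simp only [mul_comm (u _ k)]
      ring
    rw [e]
    refine (enorm_sub_le).trans (add_le_add ?_ ?_)
    · refine (enorm_integral_le_lintegral_enorm _).trans ?_
      rw [← lintegral_const_mul' _ _ ENNReal.ofReal_ne_top, ← lintegral_indicator measurableSet_ball]
      apply lintegral_mono
      intro y
      show ‖u y k * Sig (q (y - x))‖ₑ ≤ _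
      by_cases hy : y ∈ ball x 2
      · rw [Set.indicator_of_mem hy, enorm_mul, mul_comm]
        gcongr
        · rw [Real.enorm_eq_ofReal_abs]
          exact ENNReal.ofReal_le_ofReal (hC _)
        · exact hcomp k y
      · rw [Set.indicator_of_notMem hy, Sig_large]
        · simp
        · simp [dist_eq_norm] at hy; rw [q_eq]; nlinarith
    · have each : ∀ i j, ‖∫ y, u y i * u y j * Tk (deriv (aN N)) (deriv (deriv (aN N))) k i j (y - x)‖ₑ ≤
          ENNReal.ofReal CT * ∫⁻ y, Ker (x - y) * ‖u y‖ₑ ^ 2 := by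
        intro i j
        refine (enorm_integral_le_lintegral_enorm _).trans ?_
        rw [← lintegral_const_mul' _ _ ENNReal.ofReal_ne_top]
        apply lintegral_mono
        intro y
        simp only [enorm_mul]
        have := hT N hN k i j (y - x)
        rw [← Real.enorm_eq_ofReal_abs, ← neg_sub x y, Ker_neg, neg_sub] at this
        calc _ ≤ ‖u y‖ₑ * ‖u y‖ₑ * (ENNReal.ofReal CT * Ker (x - y)) := by
              gcongr <;> apply hcomp
          _ = _ := by ring
      calc _ ≤ ∑ i, ∑ j, ‖∫ y, u y i * u y j * Tk (deriv (aN N)) (deriv (deriv (aN N))) k i j (y - x)‖ₑ := by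
            refine (enorm_sum_le _ _).trans ?_
            exact Finset.sum_le_sum fun i _ => enorm_sum_le _ _
        _ ≤ ∑ i : Fin 3, ∑ j : Fin 3, ENNReal.ofReal CT * ∫⁻ y, Ker (x - y) * ‖u y‖ₑ ^ 2 :=
            Finset.sum_le_sum fun i _ => Finset.sum_le_sum fun j _ => each i j
        _ = _ := by
            simp only [Finset.sum_const, Finset.card_univ, Fintype.card_fin, nsmul_eq_mul]
            push_cast; ring
  refine ⟨3 * (ENNReal.ofReal cS)⁻¹ * (ENNReal.ofReal C + 9 * ENNReal.ofReal CT), ?_, ?_⟩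
  · refine ENNReal.mul_ne_top (ENNReal.mul_ne_top (by norm_num) ?_) ?_
    · rw [ENNReal.inv_ne_top]; simpa using cS_pos
    · exact ENNReal.add_ne_top.2 ⟨ENNReal.ofReal_ne_top, ENNReal.mul_ne_top (by norm_num) ENNReal.ofReal_ne_top⟩
  have hall : ∀ᵐ x : E3, ∀ k : Fin 3, Tendsto (fun n : ℕ => ∫ y, ((n:ℝ) + 1) ^ 3 * Sig (((n:ℝ) + 1) ^ 2 * q (y - x)) * u y k) atTop (𝓝 (cS * u x k)) :=
    ae_all_iff.2 fun k => ae_lim _ (uj k)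
  filter_upwards [hall] with x hx
  have hk : ∀ k, ENNReal.ofReal cS * ‖u x k‖ₑ ≤ D x := by
    intro k
    have h1 := le_of_tendsto (hx k).enorm (Eventually.of_forall fun n : ℕ => step k x ((n:ℝ) + 1) (by simp))
    rwa [enorm_mul, Real.enorm_eq_ofReal cS_pos.le] at h1
  have hc0 : ENNReal.ofReal cS ≠ 0 := by simpa using cS_pos
  have hk' : ∀ k, ‖u x k‖ₑ ≤ (ENNReal.ofReal cS)⁻¹ * D x := by
    intro k
    rw [← ENNReal.div_eq_inv_mul, ENNReal.le_div_iff_mul_le (Or.inl hc0) (Or.inl ENNReal.ofReal_ne_top), mul_comm]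
    exact hk k
  have hsum : ‖u x‖ₑ ≤ ∑ k, ‖u x k‖ₑ := by
    have : u x = ∑ k, EuclideanSpace.single k (u x k) := by
      ext j; simp
    conv_lhs => rw [this]
    refine (enorm_sum_le _ _).trans (Finset.sum_le_sum fun k _ => ?_)
    rw [enorm_le_iff_norm_le]; simp
  calc ‖u x‖ₑ ≤ ∑ k : Fin 3, (ENNReal.ofReal cS)⁻¹ * D x := hsum.trans (Finset.sum_le_sum fun k _ => hk' k)
    _ = 3 * (ENNReal.ofReal cS)⁻¹ * D x := by simp; ring
    _ ≤ 3 * (ENNReal.ofReal cS)⁻¹ * ((ENNReal.ofReal C + 9 * ENNReal.ofReal CT) * ((∫⁻ y in ball x 2, ‖u y‖ₑ) + ∫⁻ y, Ker (x - y) * ‖u y‖ₑ ^ 2)) := by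
        gcongr
        rw [hD]
        simp only
        rw [mul_add]
        gcongr
        · exact le_self_add
        · exact le_add_self
    _ = _ := by ring

/-- local integrability of `|u|^{1/a}` -/
def locA (u : E3 → E3) (a : ℝ) : Prop := ∀ R : ℝ, ∫⁻ x in ball (0 : E3) R, ‖u x‖ₑ ^ (1 / a) < ⊤

def wR (u : E3 → E3) (R : ℝ) : E3 → ℝ≥0∞ := (ball (0 : E3) R).indicator (fun x => ‖u x‖ₑ ^ 2)

lemma wR_meas {u : E3 → E3} (hu : Measurable u) (R : ℝ) : Measurable (wR u R) := 
  (hu.enorm.pow_const 2).indicator measurableSet_ball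

lemma wR_int {u : E3 → E3} (hu : Measurable u) {a b : ℝ} (ha : 0 < a) (hb : 0 < b)
    (h1 : locA u a) (h2 : locA u b) (R : ℝ) : ∫⁻ x, wR u R x ^ (1 / (a + b)) < ⊤ := by
  have hab : 0 < a + b := by positivity
  have hc : ((a + b) / a).HolderConjugate ((a + b) / b) := by
    rw [Real.holderConjugate_iff]
    constructor
    · rw [lt_div_iff₀ ha]; linarith
    · field_simp
  have e : ∀ x, wR u R x ^ (1 / (a + b)) = (ball (0 : E3) R).indicator
      (fun x => ‖u x‖ₑ ^ (1 / (a + b)) * ‖u x‖ₑ ^ (1 / (a + b))) x := by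
    intro x
    by_cases hx : x ∈ ball (0 : E3) R
    · rw [wR, Set.indicator_of_mem hx, Set.indicator_of_mem hx, pow_two, ENNReal.mul_rpow_of_nonneg _ _ (by positivity)]
    · rw [wR, Set.indicator_of_notMem hx, Set.indicator_of_notMem hx, ENNReal.zero_rpow_of_pos (by positivity)]
  simp only [e]
  rw [lintegral_indicator measurableSet_ball]
  have hm : AEMeasurable (fun x => ‖u x‖ₑ ^ (1 / (a + b))) (volume.restrict (ball (0 : E3) R)) :=
    (hu.enorm.pow_const _).aemeasurable
  refine (ENNReal.lintegral_mul_le_Lp_mul_Lq _ hc hm hm).trans_lt ?_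
  simp only [← ENNReal.rpow_mul]
  rw [show 1 / (a + b) * ((a + b) / a) = 1 / a by field_simp, show 1 / (a + b) * ((a + b) / b) = 1 / b by field_simp]
  exact ENNReal.mul_lt_top (ENNReal.rpow_lt_top_of_nonneg (by positivity) (h1 R).ne)
    (ENNReal.rpow_lt_top_of_nonneg (by positivity) (h2 R).ne)

lemma rpow_le_one_add {v : ℝ≥0∞} {p q : ℝ} (hp : 0 ≤ p) (h : p ≤ q) : v ^ p ≤ 1 + v ^ q := by
  rcases le_total v 1 with hv | hv
  · exact (ENNReal.rpow_le_one hv hp).trans le_self_add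
  · exact (ENNReal.rpow_le_rpow_of_exponent_le hv h).trans le_add_self

lemma locA_mono {u : E3 → E3} {a b : ℝ} (ha : 0 < a) (hab : a ≤ b)
    (h : locA u a) : locA u b := by
  intro R
  have hb : 0 < b := by linarith
  calc _ ≤ ∫⁻ x in ball (0 : E3) R, (1 + ‖u x‖ₑ ^ (1 / a)) := 
        lintegral_mono fun x => rpow_le_one_add (by positivity) (one_div_le_one_div_of_le ha hab)
    _ = volume (ball (0 : E3) R) + ∫⁻ x in ball (0 : E3) R, ‖u x‖ₑ ^ (1 / a) := by
        rw [lintegral_add_left measurable_const]; simp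
    _ < ⊤ := ENNReal.add_lt_top.2 ⟨measure_ball_lt_top, h R⟩

def PtIneq (u : E3 → E3) (C : ℝ≥0∞) : Prop :=
  ∀ᵐ x : E3, ‖u x‖ₑ ≤ C * ((∫⁻ y in ball x 2, ‖u y‖ₑ) + ∫⁻ y, Ker (x - y) * ‖u y‖ₑ ^ 2)

lemma pt_loc {u : E3 → E3} {C : ℝ≥0∞} (h : PtIneq u C) (R : ℝ) :
    ∀ᵐ x : E3, x ∈ ball (0 : E3) R → ‖u x‖ₑ ≤ C * ((∫⁻ y in ball 0 (R + 2), ‖u y‖ₑ) +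
      ∫⁻ y, Ker (x - y) * wR u (R + 2) y) := by
  filter_upwards [h] with x hx hxR
  refine hx.trans ?_
  have hx0 : ‖x‖ < R := by simpa using hxR
  gcongr C * (?_ + ?_)
  · apply lintegral_mono_set
    intro y hy
    have hy : ‖y - x‖ < 2 := by simpa [dist_eq_norm] using hy
    have := norm_add_le (y - x) x
    simp at this ⊢; linarith
  · apply lintegral_mono
    intro y
    by_cases hy : y ∈ ball (0 : E3) (R + 2)
    · simp [wR, Set.indicator_of_mem hy]
    · have : Ker (x - y) = 0 := by
        rw [Ker, Set.indicator_of_notMem]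
        intro hxy
        apply hy
        simp at hxy ⊢
        have := norm_sub_le x (x - y)
        simp at this; linarith
      simp [this]

lemma boot_step {u : E3 → E3} (hu : Measurable u) {C : ℝ≥0∞} (hC : C ≠ ⊤) (h : PtIneq u C)
    {a b κ : ℝ} (hκ : 0 < κ) (hb : 0 < b) (hb3 : b + κ < 1 / 3) (ha : κ < a) (hab : a ≤ b)
    (h1 : locA u a) (h2 : locA u b) : locA u (a - κ) := by
  intro R
  have hL1 : ∫⁻ y in ball 0 (R + 2), ‖u y‖ₑ < ⊤ := by
    have := locA_mono hb (by linarith : b ≤ 1) h2 (R + 2)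
    simpa using this
  set B := ∫⁻ y in ball 0 (R + 2), ‖u y‖ₑ with hB
  set g : E3 → ℝ≥0∞ := fun x => ∫⁻ y, Ker (x - y) * wR u (R + 2) y with hg
  have hr : 0 < 1 / (a - κ) := by apply one_div_pos.2; linarith
  have hr1 : 1 ≤ 1 / (a - κ) := by rw [le_div_iff₀ (by linarith)]; linarith
  have hs0 : 0 < 1 - b - κ := by linarith
  have hs : 1 ≤ 1 / (1 - b - κ) := by rw [le_div_iff₀ hs0]; linarith
  have hs2 : 1 / (1 - b - κ) < 3 / 2 := by rw [div_lt_iff₀ hs0]; linarith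
  have ht : 1 ≤ 1 / (a + b) := by rw [le_div_iff₀ (by linarith)]; linarith
  have hy : ∫⁻ x, g x ^ (1 / (a - κ)) < ⊤ := by
    apply young_lt_top Ker (wR u (R + 2)) Ker_meas (wR_meas hu _) (1 / (1 - b - κ)) (1 / (a + b)) _ hs ht hr
    · simp; ring
    · exact Ker_int _ (by linarith) hs2
    · exact wR_int hu (by linarith) hb h1 h2 _
  calc ∫⁻ x in ball (0 : E3) R, ‖u x‖ₑ ^ (1 / (a - κ))
      ≤ ∫⁻ x in ball (0 : E3) R, C ^ (1 / (a - κ)) * (2 ^ (1 / (a - κ) - 1) * (B ^ (1 / (a - κ)) + g x ^ (1 / (a - κ)))) := by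
        apply lintegral_mono_ae
        rw [ae_restrict_iff' measurableSet_ball]
        filter_upwards [pt_loc h R] with x hx hxR
        calc _ ≤ (C * (B + g x)) ^ (1 / (a - κ)) := ENNReal.rpow_le_rpow (hx hxR) hr.le
          _ = C ^ (1 / (a - κ)) * (B + g x) ^ (1 / (a - κ)) := ENNReal.mul_rpow_of_nonneg _ _ hr.le
          _ ≤ _ := by
            gcongr
            exact ENNReal.rpow_add_le_mul_rpow_add_rpow B (g x) hr1
    _ = C ^ (1 / (a - κ)) * (2 ^ (1 / (a - κ) - 1) * (B ^ (1 / (a - κ)) * volume (ball (0 : E3) R) + ∫⁻ x in ball (0 : E3) R, g x ^ (1 / (a - κ)))) := by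
        rw [lintegral_const_mul' _ _ (ENNReal.rpow_ne_top_of_nonneg hr.le hC),
          lintegral_const_mul' _ _ (ENNReal.rpow_ne_top_of_nonneg (by linarith) (by norm_num)),
          lintegral_add_left measurable_const]
        simp
    _ < ⊤ := by
        refine ENNReal.mul_lt_top (ENNReal.rpow_lt_top_of_nonneg hr.le hC) (ENNReal.mul_lt_top (ENNReal.rpow_lt_top_of_nonneg (by linarith) (by norm_num)) (ENNReal.add_lt_top.2 ⟨?_, ?_⟩))
        · exact ENNReal.mul_lt_top (ENNReal.rpow_lt_top_of_nonneg hr.le hL1.ne) measure_ball_lt_top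
        · exact (setLIntegral_le_lintegral _ _).trans_lt hy

lemma boot_sup {u : E3 → E3} (hu : Measurable u) {C : ℝ≥0∞} (hC : C ≠ ⊤) (h : PtIneq u C)
    {b κ : ℝ} (hκ : 0 < κ) (hb : 0 < b) (hb3 : b + κ < 1 / 3)
    (h1 : locA u κ) (h2 : locA u b) (R : ℝ) :
    ∃ M : ℝ≥0∞, M ≠ ⊤ ∧ ∀ᵐ x : E3, x ∈ ball (0 : E3) R → ‖u x‖ₑ ≤ M := by
  have hL1 : ∫⁻ y in ball 0 (R + 2), ‖u y‖ₑ < ⊤ := by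
    have := locA_mono hb (by linarith : b ≤ 1) h2 (R + 2)
    simpa using this
  have hs0 : 0 < 1 - b - κ := by linarith
  have hs2 : 1 / (1 - b - κ) < 3 / 2 := by rw [div_lt_iff₀ hs0]; linarith
  have hc : (1 / (1 - b - κ)).HolderConjugate (1 / (κ + b)) := by
    rw [Real.holderConjugate_iff]
    constructor
    · rw [lt_div_iff₀ hs0]; linarith
    · simp; ring
  refine ⟨C * ((∫⁻ y in ball 0 (R + 2), ‖u y‖ₑ) + (∫⁻ x, Ker x ^ (1 / (1 - b - κ))) ^ (1 / (1 / (1 - b - κ))) * (∫⁻ x, wR u (R + 2) x ^ (1 / (κ + b))) ^ (1 / (1 / (κ + b)))), ?_, ?_⟩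
  · refine ENNReal.mul_ne_top hC (ENNReal.add_ne_top.2 ⟨hL1.ne, ENNReal.mul_ne_top ?_ ?_⟩)
    · exact ENNReal.rpow_ne_top_of_nonneg (by positivity) (Ker_int _ (by positivity) hs2).ne
    · exact ENNReal.rpow_ne_top_of_nonneg (by positivity) (wR_int hu hκ hb h1 h2 _).ne
  · filter_upwards [pt_loc h R] with x hx hxR
    refine (hx hxR).trans ?_
    gcongr
    exact young_sup Ker (wR u (R + 2)) Ker_meas (wR_meas hu _) _ _ hc x

/-- local boundedness -/
lemma boot (u : E3 → E3) (P : E3 → ℝ) (hu : Measurable u) (hul : LocallyIntegrable u volume)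
    (hweak : IsWeakSolutionNS u P) {p : ℝ} (hp : 3 < p)
    (hloc : ∀ R : ℝ, ∫⁻ x in ball (0 : E3) R, ‖u x‖ₑ ^ p < ⊤) (R : ℝ) :
    ∃ M : ℝ≥0∞, M ≠ ⊤ ∧ ∀ᵐ x : E3, x ∈ ball (0 : E3) R → ‖u x‖ₑ ≤ M := by
  obtain ⟨C, hC, hpt⟩ := ptwise u P hu hul hweak
  have hp0 : 0 < p := by linarith
  have hb : 0 < 1 / p := by positivity
  have hbl : locA u (1 / p) := by intro R; simpa using hloc R
  have hb3 : 1 / p < 1 / 3 := one_div_lt_one_div_of_lt (by norm_num) hp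
  obtain ⟨n, hn⟩ := exists_nat_gt ((1 / p) / (1 / 3 - 1 / p))
  set M : ℕ := n + 1 with hM
  have hM0 : (0:ℝ) < M := by rw [hM]; positivity
  set κ := 1 / p / M with hκdef
  have hκ : 0 < κ := by positivity
  have hMκ : M * κ = 1 / p := by rw [hκdef]; field_simp
  have hsum : 1 / p + κ < 1 / 3 := by
    rw [div_lt_iff₀ (by linarith)] at hn
    have : (n:ℝ) < M := by rw [hM]; push_cast; linarith
    have : κ < 1 / 3 - 1 / p := by
      rw [hκdef, div_lt_iff₀ hM0]; nlinarith
    linarith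
  have ind : ∀ k : ℕ, k < M → locA u ((M - k) * κ) := by
    intro k
    induction k with
    | zero => intro _; simpa [hMκ] using hbl
    | succ k ih =>
      intro hk
      have h1 := ih (by omega)
      have hk' : (k:ℝ) + 1 < M := by exact_mod_cast hk
      have := boot_step hu hC hpt hκ hb hsum (a := (M - k) * κ) (by nlinarith) (by rw [← hMκ]; nlinarith [(Nat.cast_nonneg k : (0:ℝ) ≤ k)]) h1 hbl
      convert this using 1
      push_cast; ring
  have hlast := ind n (by omega)
  have : ((M:ℝ) - n) * κ = κ := by rw [hM]; push_cast; ring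
  rw [this] at hlast
  exact boot_sup hu hC hpt hκ hb hsum hlast hbl R

/-- convolution -/
def mo (g f : E3 → ℝ) : E3 → ℝ := convolution g f (ContinuousLinearMap.lsmul ℝ ℝ) volume

lemma mo_apply (g f : E3 → ℝ) (x : E3) : mo g f x = ∫ y, g (x - y) * f y := by
  rw [mo, convolution_lsmul_swap]; rfl

lemma mo_sm {g f : E3 → ℝ} (hg : Sm g) (hc : HasCompactSupport g) (hf : LocallyIntegrable f volume) :
    Sm (mo g f) := hc.contDiff_convolution_left _ hg hf

lemma pd_mo {g f : E3 → ℝ} (hg : Sm g) (hc : HasCompactSupport g) (hf : LocallyIntegrable f volume) (i : Fin 3) :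
    pd i (mo g f) = mo (pd i g) f := by
  funext x
  have h := hc.hasFDerivAt_convolution_left (ContinuousLinearMap.lsmul ℝ ℝ) (hg.of_le (by exact_mod_cast le_top)) hf x
  rw [pd, mo, h.fderiv, mo, convolution_def, convolution_def]
  rw [ContinuousLinearMap.integral_apply]
  · rfl
  · have := (hc.fderiv ℝ).convolutionExists_left ((ContinuousLinearMap.lsmul ℝ ℝ).precompL E3 (𝕜 := ℝ) (E := ℝ) (Fₗ := ℝ) (Gₗ := ℝ))
      (hg.continuous_fderiv (by simp)) hf x
    exact this

lemma lap_mo {g f : E3 → ℝ} (hg : Sm g) (hc : HasCompactSupport g) (hf : LocallyIntegrable f volume) (x : E3) :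
    lap3 (mo g f) x = ∑ i, mo (pd i (pd i g)) f x := by
  unfold lap3
  refine Finset.sum_congr rfl fun i _ => ?_
  rw [pd_mo hg hc hf, pd_mo (hg.dpd i) (pd_hcs hc i) hf]

lemma mo_int {g f : E3 → ℝ} (hg : Continuous g) (hc : HasCompactSupport g) (hf : LocallyIntegrable f volume) (x : E3) :
    Integrable (fun y => g (x - y) * f y) := by
  have := hf.integrable_smul_left_of_hasCompactSupport (g := fun y => g (x - y))
    (hg.comp (continuous_const.sub continuous_id)) (hc.comp_homeomorph (Homeomorph.subLeft x))
  simpa using this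

def phi (n : ℕ) : ContDiffBump (0 : E3) where
  rIn := 1 / (2 * ((n:ℝ) + 1))
  rOut := 1 / ((n:ℝ) + 1)
  rIn_pos := by positivity
  rIn_lt_rOut := by
    apply one_div_lt_one_div_of_lt (by positivity)
    have : (0:ℝ) ≤ n := by positivity
    linarith

def eta (n : ℕ) : E3 → ℝ := (phi n).normed volume

lemma eta_sm (n : ℕ) : Sm (eta n) := (phi n).contDiff_normed
lemma eta_hcs (n : ℕ) : HasCompactSupport (eta n) := (phi n).hasCompactSupport_normed
lemma eta_nonneg (n : ℕ) (x : E3) : 0 ≤ eta n x := (phi n).nonneg_normed x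
lemma eta_int (n : ℕ) : ∫ x, eta n x = 1 := (phi n).integral_normed
lemma eta_zero (n : ℕ) {x : E3} (hx : 1 ≤ ‖x‖) : eta n x = 0 := by
  by_contra h
  have : x ∈ Function.support (eta n) := h
  rw [eta, (phi n).support_normed_eq] at this
  have h1 : ‖x‖ < (phi n).rOut := by simpa using this
  change ‖x‖ < 1 / ((n:ℝ) + 1) at h1
  have h2 : 1 / ((n:ℝ) + 1) ≤ 1 := by
    rw [div_le_one (by positivity)]
    have : (0:ℝ) ≤ n := by positivity
    linarith
  linarith

lemma eta_lint (n : ℕ) : ∫⁻ x, ‖eta n x‖ₑ = 1 := by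
  have h := ofReal_integral_eq_lintegral_ofReal (f := eta n) (μ := volume) (phi n).integrable_normed (Eventually.of_forall (eta_nonneg n))
  rw [eta_int] at h
  simp only [Real.enorm_eq_ofReal (eta_nonneg n _)]
  rw [← h]; simp

lemma mo_ae {f : E3 → ℝ} (hf : LocallyIntegrable f volume) :
    ∀ᵐ x : E3, Tendsto (fun n => mo (eta n) f x) atTop (𝓝 (f x)) := by
  apply ContDiffBump.ae_convolution_tendsto_right_of_locallyIntegrable (φ := phi) (K := 2) _ _ hf
  · exact tendsto_one_div_add_atTop_nhds_zero_nat
  · filter_upwards with n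
    simp only [phi]
    apply le_of_eq; field_simp

lemma mo_enorm (n : ℕ) (f : E3 → ℝ) {R : ℝ} {x : E3} (hx : x ∈ closedBall (0 : E3) R) :
    ‖mo (eta n) f x‖ₑ ≤ ∫⁻ y, ‖eta n (x - y)‖ₑ * (closedBall (0 : E3) (R + 1)).indicator (fun y => ‖f y‖ₑ) y := by
  rw [mo_apply]
  refine (enorm_integral_le_lintegral_enorm _).trans (lintegral_mono fun y => ?_)
  show ‖eta n (x - y) * f y‖ₑ ≤ _
  rw [enorm_mul]
  by_cases hy : y ∈ closedBall (0 : E3) (R + 1)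
  · rw [Set.indicator_of_mem hy]
  · rw [eta_zero n]
    · simp
    · simp at hx hy
      have := norm_sub_le x (x - y)
      simp at this
      linarith

lemma mo_Lp (n : ℕ) {f : E3 → ℝ} (hf : Measurable f) (R r : ℝ) (hr : 1 ≤ r) :
    ∫⁻ x in closedBall (0 : E3) R, ‖mo (eta n) f x‖ₑ ^ r ≤ ∫⁻ x in closedBall (0 : E3) (R + 1), ‖f x‖ₑ ^ r := by
  have h := young_mollify (fun x => ‖eta n x‖ₑ) ((closedBall (0 : E3) (R + 1)).indicator (fun y => ‖f y‖ₑ))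
    (eta_sm n).continuous.measurable.enorm (hf.enorm.indicator measurableSet_closedBall) r hr (eta_lint n)
  have e : ∫⁻ x, ((closedBall (0 : E3) (R + 1)).indicator (fun y => ‖f y‖ₑ) x) ^ r =
      ∫⁻ x in closedBall (0 : E3) (R + 1), ‖f x‖ₑ ^ r := by
    rw [← lintegral_indicator measurableSet_closedBall]
    congr 1; funext x
    by_cases hx : x ∈ closedBall (0 : E3) (R + 1)
    · simp only [Set.indicator_of_mem hx]
    · simp only [Set.indicator_of_notMem hx]; exact ENNReal.zero_rpow_of_pos (by linarith)
  rw [e] at h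
  refine le_trans ?_ h
  refine le_trans ?_ (setLIntegral_le_lintegral (closedBall (0 : E3) R) _)
  apply setLIntegral_mono' measurableSet_closedBall
  intro x hx
  exact ENNReal.rpow_le_rpow (mo_enorm n f hx) (by linarith)

lemma mo_bd (n : ℕ) {f : E3 → ℝ} {M R : ℝ} (hM : 0 ≤ M)
    (h : ∀ᵐ x : E3, x ∈ closedBall (0 : E3) (R + 1) → |f x| ≤ M) {x : E3} (hx : x ∈ closedBall (0 : E3) R) :
    |mo (eta n) f x| ≤ M := by
  have h1 : ‖mo (eta n) f x‖ₑ ≤ ENNReal.ofReal M := by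
    refine (mo_enorm n f hx).trans ?_
    calc _ ≤ ∫⁻ y, ‖eta n (x - y)‖ₑ * ENNReal.ofReal M := by
          apply lintegral_mono_ae
          filter_upwards [h] with y hy
          gcongr
          by_cases hy' : y ∈ closedBall (0 : E3) (R + 1)
          · rw [Set.indicator_of_mem hy', Real.enorm_eq_ofReal_abs]
            exact ENNReal.ofReal_le_ofReal (hy hy')
          · rw [Set.indicator_of_notMem hy']; exact zero_le
      _ = _ := by
          rw [lintegral_mul_const' _ _ ENNReal.ofReal_ne_top, lintegral_sub_left_eq_self (fun y => ‖eta n y‖ₑ) x, eta_lint, one_mul]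
  rw [Real.enorm_eq_ofReal_abs] at h1
  exact (ENNReal.ofReal_le_ofReal_iff hM).1 h1

lemma mo_eq (u : E3 → E3) (P : E3 → ℝ)
    (hu1 : ∀ j, LocallyIntegrable (fun y => u y j)) (hu2 : ∀ i j, LocallyIntegrable (fun y => u y i * u y j))
    (hP : LocallyIntegrable P) (hweak : IsWeakSolutionNS u P) {g : E3 → ℝ} (hg : Sm g) (hc : HasCompactSupport g) (j : Fin 3) (x : E3) :
    lap3 (mo g (fun y => u y j)) x = ∑ i, pd i (mo g (fun y => u y i * u y j)) x + pd j (mo g P) x := by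
  have hgs : Sm (fun y => g (x - y)) := hg.comp (contDiff_const.sub contDiff_id)
  have hcs : HasCompactSupport (fun y => g (x - y)) := hc.comp_homeomorph (Homeomorph.subLeft x)
  have pr : ∀ i, pd i (fun y => g (x - y)) = fun y => - pd i g (x - y) := fun i => by
    funext y; exact pd_comp_rsub i g hg.diff x y
  have pr2 : ∀ i, pd i (fun y => - pd i g (x - y)) = fun y => pd i (pd i g) (x - y) := fun i => by
    funext y
    have := pd_comp_rsub i (pd i g) (hg.dpd i).diff x y
    have e : (fun y => - pd i g (x - y)) = fun y => (fun _ => (-1:ℝ)) y * pd i g (x - y) := by funext; simp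
    have hd : DifferentiableAt ℝ (fun y => pd i g (x - y)) y := ((hg.dpd i).diff (x - y)).comp y (by fun_prop)
    rw [e, pd_mul (differentiableAt_const _) hd, this, pd_const]
    simp
  have t := hweak.1 (fun y => EuclideanSpace.single j (g (x - y)))
    (by
      rw [contDiff_euclidean]
      intro k
      by_cases h : k = j
      · subst h; simpa using hgs
      · simpa [h] using contDiff_const)
    (hcs.comp_left (g := fun t => EuclideanSpace.single j t) (by simp))
  have co : ∀ k, (fun y => (EuclideanSpace.single j (g (x - y)) : E3) k) = if k = j then (fun y => g (x - y)) else fun _ => 0 := by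
    intro k; funext y; by_cases h : k = j <;> simp [h]
  have p0 : ∀ i, pd i (fun _ => (0:ℝ)) = fun _ => 0 := fun i => by funext y; exact pd_const 0 y
  have e1 : ∀ y, ∑ k, u y k * lap3 (fun y => (EuclideanSpace.single j (g (x - y)) : E3) k) y = ∑ i, pd i (pd i g) (x - y) * u y j := by
    intro y
    rw [Finset.sum_eq_single j]
    · rw [co]; simp only [if_true, lap3, pr, pr2, Finset.mul_sum]
      exact Finset.sum_congr rfl fun i _ => mul_comm _ _
    · intro k _ hk
      rw [co, if_neg hk]; simp [lap3, p0]
    · simp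
  have e2 : ∀ i, ∑ k, ∫ y, u y i * u y k * pd i (fun y => (EuclideanSpace.single j (g (x - y)) : E3) k) y = - ∫ y, pd i g (x - y) * (u y i * u y j) := by
    intro i
    rw [Finset.sum_eq_single j]
    · rw [co]; simp only [if_true, pr, mul_neg, integral_neg]
      congr 2; funext y; ring
    · intro k _ hk
      rw [co, if_neg hk]; simp [p0]
    · simp
  have e3 : ∀ y, P y * ∑ k, pd k (fun y => (EuclideanSpace.single j (g (x - y)) : E3) k) y = - (pd j g (x - y) * P y) := by
    intro y
    rw [Finset.sum_eq_single j]
    · rw [co]; simp only [if_true, pr]; ring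
    · intro k _ hk
      rw [co, if_neg hk]; simp [p0]
    · simp
  simp only [e1, e2, e3, integral_neg] at t
  rw [integral_finsetSum _ (fun i _ => mo_int ((hg.dpd i).dpd i).continuous (pd_hcs (pd_hcs hc i) i) (hu1 j) x)] at t
  rw [lap_mo hg hc (hu1 j)]
  simp only [pd_mo hg hc (hu2 _ j), pd_mo hg hc hP, mo_apply]
  rw [Finset.sum_neg_distrib] at t
  linarith

lemma mo_div (u : E3 → E3) (P : E3 → ℝ)
    (hu1 : ∀ j, LocallyIntegrable (fun y => u y j)) 
    (hweak : IsWeakSolutionNS u P) {g : E3 → ℝ} (hg : Sm g) (hc : HasCompactSupport g) (x : E3) :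
    ∑ j, pd j (mo g (fun y => u y j)) x = 0 := by
  have t := hweak.2 (fun y => g (x - y)) (hg.comp (contDiff_const.sub contDiff_id)) (hc.comp_homeomorph (Homeomorph.subLeft x))
  simp only [pd_comp_rsub _ g hg.diff, mul_neg, Finset.sum_neg_distrib, integral_neg, neg_eq_zero] at t
  simp only [mul_comm (u _ _)] at t
  rw [integral_finsetSum _ (fun i _ => mo_int (hg.dpd i).continuous (pd_hcs hc i) (hu1 i) x)] at t
  simp only [pd_mo hg hc (hu1 _), mo_apply]
  exact t

lemma pd_smul (i : Fin 3) (f : E3 → ℝ) (t : ℝ) (x : E3) :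
    pd i (fun y => f (t • y)) x = t * pd i f (t • x) := by
  simp [pd, fderiv_comp_smul]

lemma lap_smul (f : E3 → ℝ) (hf : Sm f) (t : ℝ) (x : E3) :
    lap3 (fun y => f (t • y)) x = t ^ 2 * lap3 f (t • x) := by
  unfold lap3
  rw [Finset.mul_sum]
  refine Finset.sum_congr rfl fun i _ => ?_
  have : pd i (fun y => f (t • y)) = fun x => (fun _ => t) x * (fun y => pd i f (t • y)) x := by
    funext x; exact pd_smul i f t x
  have hs : Sm (fun y => pd i f (t • y)) := (hf.dpd i).comp (contDiff_const_smul _)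
  rw [this, pd_mul (differentiableAt_const _) (hs.diff _), pd_const, pd_smul]
  ring

/-- unit cutoff -/
def Z1 (x : E3) : ℝ := chi (q x)

lemma Z1_sm : Sm Z1 := chi_sm.cq
lemma Z1_hcs : HasCompactSupport Z1 := hcs_q fun x hx => chi_zero (by linarith)

/-- scaled cutoff -/
def zR (R : ℝ) (x : E3) : ℝ := Z1 (R⁻¹ • x)

lemma zR_sm (R : ℝ) : Sm (zR R) := Z1_sm.comp (contDiff_const_smul _)
lemma zR_nonneg (R : ℝ) (x : E3) : 0 ≤ zR R x := Real.smoothTransition.nonneg _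
lemma zR_le (R : ℝ) (x : E3) : zR R x ≤ 1 := Real.smoothTransition.le_one _
lemma zR_one {R : ℝ} (hR : 0 < R) {x : E3} (hx : ‖x‖ ≤ R) : zR R x = 1 := by
  apply chi_one
  rw [q_eq, norm_smul, norm_inv, Real.norm_of_nonneg hR.le]
  have : R⁻¹ * ‖x‖ ≤ 1 := by rw [inv_mul_le_iff₀ hR]; linarith
  have h0 : 0 ≤ R⁻¹ * ‖x‖ := by positivity
  nlinarith
lemma zR_supp {R : ℝ} (hR : 0 < R) : tsupport (zR R) ⊆ closedBall 0 (2 * R) := by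
  apply closure_minimal _ isClosed_closedBall
  intro x hx
  by_contra h
  apply hx
  apply chi_zero
  simp at h
  rw [q_eq, norm_smul, norm_inv, Real.norm_of_nonneg hR.le]
  have : 2 ≤ R⁻¹ * ‖x‖ := by rw [le_inv_mul_iff₀ hR]; linarith
  nlinarith

lemma zR_bounds : ∃ c : ℝ, 0 ≤ c ∧ ∀ R : ℝ, 1 ≤ R → (∀ i x, |pd i (zR R) x| ≤ c / R) ∧ ∀ x, |lap3 (zR R) x| ≤ c / R ^ 2 := by
  have h1 : ∀ i, ∃ c, ∀ x, ‖pd i Z1 x‖ ≤ c := fun i =>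
    (pd_hcs Z1_hcs i).exists_bound_of_continuous (Z1_sm.dpd i).continuous
  obtain ⟨c2, h2⟩ := (lap3_hcs Z1_hcs).exists_bound_of_continuous Z1_sm.dlap.continuous
  choose c1 h1 using h1
  have hc2 : 0 ≤ c2 := (norm_nonneg _).trans (h2 0)
  have hc1 : ∀ i, 0 ≤ c1 i := fun i => (norm_nonneg _).trans (h1 i 0)
  refine ⟨c2 + ∑ i, c1 i, add_nonneg hc2 (Finset.sum_nonneg fun i _ => hc1 i), fun R hR => ⟨fun i x => ?_, fun x => ?_⟩⟩
  · unfold zR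
    rw [pd_smul, abs_mul, abs_of_nonneg (by positivity), div_eq_inv_mul]
    gcongr
    have := Finset.single_le_sum (fun i _ => hc1 i) (Finset.mem_univ i)
    have := h1 i (R⁻¹ • x)
    rw [Real.norm_eq_abs] at this
    linarith
  · unfold zR
    rw [lap_smul _ Z1_sm, abs_mul, abs_of_nonneg (by positivity), div_eq_inv_mul, inv_pow]
    gcongr
    have := Finset.sum_nonneg (fun i (_ : i ∈ Finset.univ) => hc1 i)
    have := h2 (R⁻¹ • x)
    rw [Real.norm_eq_abs] at this
    linarith

def eG (v : Fin 3 → E3 → ℝ) (p : E3 → ℝ) (c1 c2 : ℝ) (x : E3) : ℝ :=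
  c2 * (∑ j, v j x ^ 2) + c1 * ((∑ j, v j x ^ 2) + 2 * |p x|) * ∑ i, |v i x|
def eH (v : Fin 3 → E3 → ℝ) (F : Fin 3 → Fin 3 → E3 → ℝ) (c1 : ℝ) (x : E3) : ℝ :=
  2 * c1 * (∑ i, ∑ j, |v j x| * |F i j x - v i x * v j x|) + ∑ i, ∑ j, (F i j x - v i x * v j x) ^ 2

lemma eBd_eq (v : Fin 3 → E3 → ℝ) (F : Fin 3 → Fin 3 → E3 → ℝ) (p : E3 → ℝ) (c1 c2 : ℝ) (x : E3) :
    eBd v F p c1 c2 x = eG v p c1 c2 x + eH v F c1 x := by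
  unfold eBd eG eH; ring

lemma eH_nonneg (v : Fin 3 → E3 → ℝ) (F : Fin 3 → Fin 3 → E3 → ℝ) {c1 : ℝ} (h : 0 ≤ c1) (x : E3) :
    0 ≤ eH v F c1 x := by unfold eH; positivity

lemma sq_cube {R t : ℝ} (hR : 0 < R) (ht : 0 ≤ t) : t ^ 2 ≤ R * t ^ 3 + (R ^ 2)⁻¹ := by
  by_cases h : 1 ≤ R * t
  · have : t ^ 2 * 1 ≤ t ^ 2 * (R * t) := by gcongr
    have : 0 ≤ (R ^ 2)⁻¹ := by positivity
    nlinarith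
  · have h : R * t ≤ 1 := by linarith
    have h3 : t ≤ R⁻¹ := by rw [← one_div, le_div_iff₀ hR]; linarith
    have : t ^ 2 ≤ R⁻¹ ^ 2 := by gcongr
    rw [inv_pow] at this
    have : 0 ≤ R * t ^ 3 := by positivity
    linarith

lemma mul_young {a t : ℝ} (ha : 0 ≤ a) (ht : 0 ≤ t) : a * t ≤ a ^ (3/2 : ℝ) + t ^ 3 := by
  have h := Real.young_inequality_of_nonneg ha ht (p := 3/2) (q := 3) (by constructor <;> norm_num)
  have h1 : 0 ≤ a ^ (3/2 : ℝ) := by positivity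
  have h2 : t ^ (3:ℝ) = t ^ 3 := by norm_cast
  rw [h2] at h
  have h3 : 0 ≤ t ^ 3 := by positivity
  linarith

lemma sum_cube (a b c : ℝ) (ha : 0 ≤ a) (hb : 0 ≤ b) (hc : 0 ≤ c) :
    (a ^ 2 + b ^ 2 + c ^ 2) * (a + b + c) ≤ 9 * (a ^ 3 + b ^ 3 + c ^ 3) := by
  nlinarith [mul_nonneg (add_nonneg ha hb) (sq_nonneg (a - b)), mul_nonneg (add_nonneg ha hc) (sq_nonneg (a - c)),
    mul_nonneg (add_nonneg hb hc) (sq_nonneg (b - c)), pow_nonneg ha 3, pow_nonneg hb 3, pow_nonneg hc 3]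

lemma eG_le (v : Fin 3 → E3 → ℝ) (p : E3 → ℝ) {c R : ℝ} (hc : 0 ≤ c) (hR : 1 ≤ R) (x : E3) :
    eG v p (c / R) (c / R ^ 2) x ≤ c / R * (12 * (∑ j, |v j x| ^ 3) + 6 * |p x| ^ (3/2 : ℝ) + 3 * (R ^ 3)⁻¹) := by
  unfold eG
  simp only [Fin.sum_univ_three]
  have hR0 : 0 < R := by linarith
  have s := fun j => sq_cube hR0 (abs_nonneg (v j x))
  have m := fun j => mul_young (abs_nonneg (p x)) (abs_nonneg (v j x))
  have t := sum_cube _ _ _ (abs_nonneg (v 0 x)) (abs_nonneg (v 1 x)) (abs_nonneg (v 2 x))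
  have s0 := s 0; have s1 := s 1; have s2 := s 2
  have m0 := m 0; have m1 := m 1; have m2 := m 2
  simp only [sq_abs] at s0 s1 s2 t
  have e : c / R ^ 2 = c / R * R⁻¹ := by field_simp
  rw [e, mul_assoc (c / R), mul_assoc (c / R), ← mul_add]
  apply mul_le_mul_of_nonneg_left _ (by positivity)
  have k : R⁻¹ * (v 0 x ^ 2 + v 1 x ^ 2 + v 2 x ^ 2) ≤ |v 0 x| ^ 3 + |v 1 x| ^ 3 + |v 2 x| ^ 3 + 3 * (R ^ 3)⁻¹ := by
    calc _ ≤ R⁻¹ * ((R * |v 0 x| ^ 3 + (R ^ 2)⁻¹) + (R * |v 1 x| ^ 3 + (R ^ 2)⁻¹) + (R * |v 2 x| ^ 3 + (R ^ 2)⁻¹)) := by gcongr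
      _ = _ := by field_simp; ring
  nlinarith

/-- the growth functional -/
def AA (u : E3 → E3) (P : E3 → ℝ) (R : ℝ) : ℝ≥0∞ :=
  ∫⁻ x in closedBall (0 : E3) R, (‖u x‖ₑ ^ (3:ℝ) + ‖P x‖ₑ ^ (3/2:ℝ))

def vn (u : E3 → E3) (n : ℕ) (j : Fin 3) : E3 → ℝ := mo (eta n) (fun y => u y j)
def Fn (u : E3 → E3) (n : ℕ) (i j : Fin 3) : E3 → ℝ := mo (eta n) (fun y => u y i * u y j)

lemma meas_coord {u : E3 → E3} (hu : Measurable u) (j : Fin 3) : Measurable (fun y => u y j) :=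
  (EuclideanSpace.proj j : E3 →L[ℝ] ℝ).continuous.measurable.comp hu

lemma abs_coord (v : E3) (j : Fin 3) : |v j| ≤ ‖v‖ := by
  have := PiLp.norm_apply_le v j
  simpa using this

lemma G_int (u : E3 → E3) (P : E3 → ℝ) (hu : Measurable u) (hP : Measurable P)
    {c R : ℝ} (hc : 0 ≤ c) (hR : 1 ≤ R) (n : ℕ) (hsm : ∀ j, Sm (vn u n j)) (hpm : Sm (mo (eta n) P)) :
    ∫⁻ x in closedBall (0 : E3) (2 * R), ENNReal.ofReal (eG (vn u n) (mo (eta n) P) (c / R) (c / R ^ 2) x) ≤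
      ENNReal.ofReal (1 / R) * (ENNReal.ofReal c * (42 * AA u P (2 * R + 1) + 24 * volume (ball (0 : E3) 1))) := by
  have hR0 : 0 < R := by linarith
  have b1 : ∀ j, ∫⁻ x in closedBall (0 : E3) (2 * R), ENNReal.ofReal (|vn u n j x| ^ 3) ≤ AA u P (2 * R + 1) := by
    intro j
    calc _ = ∫⁻ x in closedBall (0 : E3) (2 * R), ‖vn u n j x‖ₑ ^ (3:ℝ) := by
          congr 1; funext x
          rw [Real.enorm_eq_ofReal_abs, ENNReal.ofReal_rpow_of_nonneg (abs_nonneg _) (by norm_num)]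
          norm_cast
      _ ≤ _ := mo_Lp n (meas_coord hu j) _ _ (by norm_num)
      _ ≤ _ := by
          apply lintegral_mono; intro x
          refine le_trans ?_ le_self_add
          refine ENNReal.rpow_le_rpow ?_ (by norm_num)
          rw [Real.enorm_eq_ofReal_abs, ← ofReal_norm_eq_enorm]
          exact ENNReal.ofReal_le_ofReal (abs_coord _ _)
  have b2 : ∫⁻ x in closedBall (0 : E3) (2 * R), ENNReal.ofReal (|mo (eta n) P x| ^ (3/2:ℝ)) ≤ AA u P (2 * R + 1) := by
    calc _ = ∫⁻ x in closedBall (0 : E3) (2 * R), ‖mo (eta n) P x‖ₑ ^ (3/2:ℝ) := by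
          congr 1; funext x
          rw [Real.enorm_eq_ofReal_abs, ENNReal.ofReal_rpow_of_nonneg (abs_nonneg _) (by norm_num)]
      _ ≤ _ := mo_Lp n hP _ _ (by norm_num)
      _ ≤ _ := by
          apply lintegral_mono; intro x
          exact le_add_self
  have b3 : ∫⁻ x in closedBall (0 : E3) (2 * R), ENNReal.ofReal ((R ^ 3)⁻¹) = 8 * volume (ball (0 : E3) 1) := by
    rw [setLIntegral_const, Measure.addHaar_closedBall _ _ (by positivity), ← mul_assoc, ← ENNReal.ofReal_mul (by positivity)]
    congr 1
    simp only [finrank_euclideanSpace, Fintype.card_fin]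
    have : (R ^ 3)⁻¹ * (2 * R) ^ 3 = 8 := by field_simp; norm_num
    rw [this]; norm_num
  have hm : ∀ j, Measurable (fun x => ENNReal.ofReal (|vn u n j x| ^ 3)) := fun j => by
    have := (hsm j).continuous.measurable
    fun_prop
  have hmp : Measurable (fun x => ENNReal.ofReal (|mo (eta n) P x| ^ (3/2:ℝ))) := by
    have := hpm.continuous.measurable
    fun_prop
  calc _ ≤ ∫⁻ x in closedBall (0 : E3) (2 * R), ENNReal.ofReal (c / R) *
        (12 * (∑ j, ENNReal.ofReal (|vn u n j x| ^ 3)) + 6 * ENNReal.ofReal (|mo (eta n) P x| ^ (3/2:ℝ)) + 3 * ENNReal.ofReal ((R ^ 3)⁻¹)) := by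
        apply lintegral_mono; intro x
        refine (ENNReal.ofReal_le_ofReal (eG_le (vn u n) _ hc hR x)).trans ?_
        rw [ENNReal.ofReal_mul (by positivity), ENNReal.ofReal_add (by positivity) (by positivity), ENNReal.ofReal_add (by positivity) (by positivity),
          ENNReal.ofReal_mul (by positivity), ENNReal.ofReal_mul (by positivity), ENNReal.ofReal_mul (by positivity), ENNReal.ofReal_sum_of_nonneg (fun _ _ => by positivity)]
        norm_num
    _ = ENNReal.ofReal (c / R) * (12 * (∑ j, ∫⁻ x in closedBall (0 : E3) (2 * R), ENNReal.ofReal (|vn u n j x| ^ 3))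
          + 6 * (∫⁻ x in closedBall (0 : E3) (2 * R), ENNReal.ofReal (|mo (eta n) P x| ^ (3/2:ℝ)))
          + 3 * (8 * volume (ball (0 : E3) 1))) := by
        rw [lintegral_const_mul' _ _ ENNReal.ofReal_ne_top, lintegral_add_right _ measurable_const,
          lintegral_add_right _ (hmp.const_mul _), lintegral_const_mul _ (Finset.measurable_sum _ fun j _ => hm j), lintegral_const_mul _ hmp,
          lintegral_finsetSum _ (fun j _ => hm j), lintegral_const_mul _ measurable_const, b3]
    _ ≤ ENNReal.ofReal (c / R) * (12 * (∑ j : Fin 3, AA u P (2 * R + 1)) + 6 * AA u P (2 * R + 1) + 3 * (8 * volume (ball (0 : E3) 1))) := by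
        gcongr with j
        exact b1 j
    _ = _ := by
        rw [div_eq_mul_one_div, mul_comm c, ENNReal.ofReal_mul (by positivity), mul_assoc]
        congr 2
        simp
        ring

lemma H_lim (u : E3 → E3) (hu1 : ∀ j, LocallyIntegrable (fun y => u y j)) (hu2 : ∀ i j, LocallyIntegrable (fun y => u y i * u y j))
    {M ρ c1 : ℝ} (hM : 0 ≤ M) (hc1 : 0 ≤ c1) (hb : ∀ᵐ x : E3, x ∈ closedBall (0 : E3) (ρ + 1) → ‖u x‖ ≤ M) :
    Tendsto (fun n => ∫⁻ x in closedBall (0 : E3) ρ, ENNReal.ofReal (eH (vn u n) (Fn u n) c1 x)) atTop (𝓝 0) := by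
  have hvs : ∀ n j, Sm (vn u n j) := fun n j => mo_sm (eta_sm n) (eta_hcs n) (hu1 j)
  have hFs : ∀ n i j, Sm (Fn u n i j) := fun n i j => mo_sm (eta_sm n) (eta_hcs n) (hu2 i j)
  have key := tendsto_lintegral_of_dominated_convergence (μ := volume.restrict (closedBall (0 : E3) ρ))
    (F := fun n x => ENNReal.ofReal (eH (vn u n) (Fn u n) c1 x)) (f := fun _ => 0)
    (fun _ => ENNReal.ofReal (2 * c1 * (∑ i : Fin 3, ∑ j : Fin 3, M * (M * M + M * M)) + ∑ i : Fin 3, ∑ j : Fin 3, (M * M + M * M) ^ 2)) ?_ ?_ ?_ ?_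
  · simpa using key
  · intro n
    have h1 := fun j => (hvs n j).continuous
    have h2 := fun i j => (hFs n i j).continuous
    apply Measurable.ennreal_ofReal
    apply Continuous.measurable
    unfold eH
    fun_prop
  · intro n
    filter_upwards [ae_restrict_mem measurableSet_closedBall] with x hx
    apply ENNReal.ofReal_le_ofReal
    have h1 : ∀ j, |vn u n j x| ≤ M := fun j => mo_bd n hM (by
      filter_upwards [hb] with y hy h; exact (abs_coord _ _).trans (hy h)) hx
    have h2 : ∀ i j, |Fn u n i j x| ≤ M * M := fun i j => mo_bd n (by positivity) (by
      filter_upwards [hb] with y hy h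
      rw [abs_mul]
      have a := (abs_coord (u y) i).trans (hy h)
      have b := (abs_coord (u y) j).trans (hy h)
      gcongr) hx
    have h3 : ∀ i j, |Fn u n i j x - vn u n i x * vn u n j x| ≤ M * M + M * M := fun i j => by
      refine (abs_sub _ _).trans ?_
      rw [abs_mul]
      have a := h1 i; have b := h1 j; have c := h2 i j
      gcongr
    unfold eH
    have h4 : ∀ i j, (Fn u n i j x - vn u n i x * vn u n j x) ^ 2 ≤ (M * M + M * M) ^ 2 := fun i j => by
      rw [← sq_abs]
      have := h3 i j
      gcongr
    refine add_le_add ?_ (Finset.sum_le_sum fun i _ => Finset.sum_le_sum fun j _ => h4 i j)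
    gcongr with i _ j _
    · exact h1 j
    · exact h3 i j
  · simp only [lintegral_const, Measure.restrict_apply MeasurableSet.univ, Set.univ_inter]
    exact ENNReal.mul_ne_top ENNReal.ofReal_ne_top measure_closedBall_lt_top.ne
  · apply ae_restrict_of_ae
    have a1 : ∀ᵐ x : E3, ∀ j, Tendsto (fun n => vn u n j x) atTop (𝓝 (u x j)) := ae_all_iff.2 fun j => mo_ae (hu1 j)
    have a2 : ∀ᵐ x : E3, ∀ i j, Tendsto (fun n => Fn u n i j x) atTop (𝓝 (u x i * u x j)) := 
      ae_all_iff.2 fun i => ae_all_iff.2 fun j => mo_ae (hu2 i j)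
    filter_upwards [a1, a2] with x h1 h2
    have : Tendsto (fun n => eH (vn u n) (Fn u n) c1 x) atTop (𝓝 (2 * c1 * (∑ i, ∑ j, |u x j| * |u x i * u x j - u x i * u x j|) + ∑ i, ∑ j, (u x i * u x j - u x i * u x j) ^ 2)) := by
      unfold eH
      refine (Tendsto.const_mul _ (tendsto_finsetSum _ fun i _ => tendsto_finsetSum _ fun j _ => ?_)).add
        (tendsto_finsetSum _ fun i _ => tendsto_finsetSum _ fun j _ => ?_)
      · exact (h1 j).abs.mul ((h2 i j).sub ((h1 i).mul (h1 j))).abs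
      · exact ((h2 i j).sub ((h1 i).mul (h1 j))).pow 2
    simp at this
    have := (ENNReal.continuous_ofReal.tendsto _).comp this
    simpa [Function.comp_def] using this

lemma energy_lim (u : E3 → E3) (P : E3 → ℝ) (hu : Measurable u) (hPm : Measurable P)
    (hu1 : ∀ j, LocallyIntegrable (fun y => u y j)) (hu2 : ∀ i j, LocallyIntegrable (fun y => u y i * u y j))
    (hP : LocallyIntegrable P) (hweak : IsWeakSolutionNS u P)
    (hb : ∀ R : ℝ, ∃ M : ℝ, 0 ≤ M ∧ ∀ᵐ x : E3, x ∈ closedBall (0 : E3) R → ‖u x‖ ≤ M) :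
    ∃ C : ℝ≥0∞, C ≠ ⊤ ∧ ∀ R : ℝ, 1 ≤ R → ∀ᶠ n in atTop,
      ENNReal.ofReal (∫ x, zR R x * ∑ i, ∑ j, pd i (vn u n j) x ^ 2) ≤
        ENNReal.ofReal (1 / R) * (C * (AA u P (2 * R + 1) + 1)) := by
  obtain ⟨c, hc, hz⟩ := zR_bounds
  have hvb : volume (ball (0 : E3) 1) ≠ ⊤ := measure_ball_lt_top.ne
  refine ⟨ENNReal.ofReal c * (42 + 24 * volume (ball (0 : E3) 1)) + 1, by finiteness, fun R hR => ?_⟩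
  have hR0 : 0 < R := by linarith
  obtain ⟨M, hM, hM'⟩ := hb (2 * R + 1)
  have hlim := H_lim u hu1 hu2 hM (c1 := c / R) (by positivity) hM'
  have hev := hlim.eventually_le_const (u := ENNReal.ofReal (1 / R)) (by simpa using hR0)
  filter_upwards [hev] with n hn
  have hvs : ∀ j, Sm (vn u n j) := fun j => mo_sm (eta_sm n) (eta_hcs n) (hu1 j)
  have hFs : ∀ i j, Sm (Fn u n i j) := fun i j => mo_sm (eta_sm n) (eta_hcs n) (hu2 i j)
  have hps : Sm (mo (eta n) P) := mo_sm (eta_sm n) (eta_hcs n) hP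
  have he := energy_ineq (vn u n) (Fn u n) (mo (eta n) P) (zR R) hvs hFs hps (zR_sm R)
    (fun x => mo_div u P hu1 hweak (eta_sm n) (eta_hcs n) x)
    (fun j x => mo_eq u P hu1 hu2 hP hweak (eta_sm n) (eta_hcs n) j x)
    (2 * R) (c / R) (c / R ^ 2) (zR_supp hR0) (zR_nonneg R) (zR_le R) (hz R hR).1 (hz R hR).2
  have hmH : Measurable (fun x => ENNReal.ofReal (eH (vn u n) (Fn u n) (c / R) x)) := by
    have h1 := fun j => (hvs j).continuous
    have h2 := fun i j => (hFs i j).continuous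
    apply Measurable.ennreal_ofReal
    apply Continuous.measurable
    unfold eH
    fun_prop
  calc _ ≤ ENNReal.ofReal (∫ x in closedBall 0 (2 * R), eBd (vn u n) (Fn u n) (mo (eta n) P) (c / R) (c / R ^ 2) x) := ENNReal.ofReal_le_ofReal he
    _ ≤ ‖∫ x in closedBall 0 (2 * R), eBd (vn u n) (Fn u n) (mo (eta n) P) (c / R) (c / R ^ 2) x‖ₑ := Real.ofReal_le_enorm _
    _ ≤ ∫⁻ x in closedBall 0 (2 * R), ‖eBd (vn u n) (Fn u n) (mo (eta n) P) (c / R) (c / R ^ 2) x‖ₑ := enorm_integral_le_lintegral_enorm _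
    _ ≤ ∫⁻ x in closedBall 0 (2 * R), (ENNReal.ofReal (eG (vn u n) (mo (eta n) P) (c / R) (c / R ^ 2) x) + ENNReal.ofReal (eH (vn u n) (Fn u n) (c / R) x)) := by
        apply lintegral_mono; intro x
        show ‖eBd (vn u n) (Fn u n) (mo (eta n) P) (c / R) (c / R ^ 2) x‖ₑ ≤ _
        rw [Real.enorm_eq_ofReal (eBd_nonneg _ _ _ (by positivity) (by positivity) x), eBd_eq]
        exact ENNReal.ofReal_add_le
    _ ≤ ENNReal.ofReal (1 / R) * (ENNReal.ofReal c * (42 * AA u P (2 * R + 1) + 24 * volume (ball (0 : E3) 1))) + ENNReal.ofReal (1 / R) := by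
        rw [lintegral_add_right _ hmH]
        exact add_le_add (G_int u P hu hPm hc hR n hvs hps) hn
    _ ≤ ENNReal.ofReal (1 / R) * (ENNReal.ofReal c * ((42 + 24 * volume (ball (0 : E3) 1)) * (AA u P (2 * R + 1) + 1)) + 1 * (AA u P (2 * R + 1) + 1)) := by
        rw [← mul_add_one]
        refine mul_le_mul_right (add_le_add (mul_le_mul_right ?_ _) ?_) _
        · calc _ ≤ 42 * (AA u P (2 * R + 1) + 1) + 24 * volume (ball (0 : E3) 1) * (AA u P (2 * R + 1) + 1) := by
                refine add_le_add (mul_le_mul_right ?_ _) ?_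
                · exact le_self_add
                · exact le_mul_of_one_le_right zero_le le_add_self
            _ = _ := by ring
        · rw [one_mul]; exact le_add_self
    _ = _ := by ring

lemma D_small (u : E3 → E3) (P : E3 → ℝ) {C : ℝ≥0∞} (hC : C ≠ ⊤)
    (hen : ∀ R : ℝ, 1 ≤ R → ∀ᶠ n in atTop,
      ENNReal.ofReal (∫ x, zR R x * ∑ i, ∑ j, pd i (vn u n j) x ^ 2) ≤
        ENNReal.ofReal (1 / R) * (C * (AA u P (2 * R + 1) + 1)))
    (hA : ∀ ε : ℝ, 0 < ε → ∀ᶠ R : ℝ in atTop, AA u P R ≤ ENNReal.ofReal (ε * R)) (δ : ℝ) (hδ : 0 < δ) (R0 : ℝ) :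
    ∃ R, R0 ≤ R ∧ 1 ≤ R ∧ ∀ᶠ n in atTop, ∫ x, zR R x * ∑ i, ∑ j, pd i (vn u n j) x ^ 2 ≤ δ := by
  set ε : ℝ := δ / (4 * (C.toReal + 1)) with hε
  have hε0 : 0 < ε := by positivity
  have ht : Tendsto (fun R : ℝ => 2 * R + 1) atTop atTop :=
    tendsto_atTop_add_const_right _ _ (tendsto_id.const_mul_atTop (by norm_num))
  obtain ⟨R, h1, h2, h3, h4⟩ := ((ht.eventually (hA ε hε0)).and ((eventually_ge_atTop R0).and ((eventually_ge_atTop 1).and (eventually_ge_atTop (1 / ε))))).exists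
  refine ⟨R, h2, h3, ?_⟩
  filter_upwards [hen R h3] with n hn
  have hR0 : 0 < R := by linarith
  have h5 : AA u P (2 * R + 1) + 1 ≤ ENNReal.ofReal (4 * ε * R) := by
    calc _ ≤ ENNReal.ofReal (ε * (2 * R + 1)) + ENNReal.ofReal (ε * R) := by
          gcongr
          rw [← ENNReal.ofReal_one]
          apply ENNReal.ofReal_le_ofReal
          rw [div_le_iff₀ hε0] at h4; linarith
      _ = ENNReal.ofReal (ε * (2 * R + 1) + ε * R) := (ENNReal.ofReal_add (by positivity) (by positivity)).symm
      _ ≤ _ := by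
          apply ENNReal.ofReal_le_ofReal
          nlinarith
  rw [← ENNReal.ofReal_le_ofReal_iff hδ.le]
  calc _ ≤ _ := hn
    _ ≤ ENNReal.ofReal (1 / R) * (ENNReal.ofReal C.toReal * ENNReal.ofReal (4 * ε * R)) := by
        rw [ENNReal.ofReal_toReal hC]; gcongr
    _ = ENNReal.ofReal (1 / R * (C.toReal * (4 * ε * R))) := by
        rw [← ENNReal.ofReal_mul (by positivity), ← ENNReal.ofReal_mul (by positivity)]
    _ ≤ _ := by
        apply ENNReal.ofReal_le_ofReal
        have : 1 / R * (C.toReal * (4 * ε * R)) = 4 * ε * C.toReal := by field_simp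
        rw [this]
        have : 4 * ε * (C.toReal + 1) = δ := by rw [hε]; field_simp
        nlinarith

lemma weak_grad (u : E3 → E3) (P : E3 → ℝ) (hu1 : ∀ j, LocallyIntegrable (fun y => u y j)) 
    (hb : ∀ R : ℝ, ∃ M : ℝ, 0 ≤ M ∧ ∀ᵐ x : E3, x ∈ closedBall (0 : E3) R → ‖u x‖ ≤ M) 
    (hD : ∀ δ : ℝ, 0 < δ → ∀ R0 : ℝ, 
      ∃ R, R0 ≤ R ∧ 1 ≤ R ∧ ∀ᶠ n in atTop, ∫ x, zR R x * ∑ i, ∑ j, pd i (vn u n j) x ^ 2 ≤ δ)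
    {ψ : E3 → ℝ} (hψ : Sm ψ) (hc : HasCompactSupport ψ) (i j : Fin 3) : ∫ x, u x j * pd i ψ x = 0 := by
  have hvs : ∀ n j, Sm (vn u n j) := fun n j => mo_sm (eta_sm n) (eta_hcs n) (hu1 j)
  obtain ⟨R0, hR0⟩ := hc.isCompact.isBounded.subset_closedBall (0 : E3)
  obtain ⟨M, hM, hM'⟩ := hb (R0 + 1)
  have hlim : Tendsto (fun n => ∫ x, vn u n j x * pd i ψ x) atTop (𝓝 (∫ x, u x j * pd i ψ x)) := by
    apply tendsto_integral_of_dominated_convergence (fun x => M * |pd i ψ x|)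
    · intro n
      exact ((hvs n j).continuous.mul (hψ.dpd i).continuous).aestronglyMeasurable
    · exact ((hψ.dpd i).continuous.integrable_of_hasCompactSupport (pd_hcs hc i)).abs.const_mul M
    · intro n
      refine Eventually.of_forall fun x => ?_
      rw [norm_mul, Real.norm_eq_abs, Real.norm_eq_abs]
      by_cases hx : x ∈ tsupport ψ
      · have := mo_bd n hM (f := fun y => u y j) (R := R0) (by
          filter_upwards [hM'] with y hy h; exact (abs_coord _ _).trans (hy h)) (hR0 hx)
        exact mul_le_mul_of_nonneg_right this (abs_nonneg _)
      · rw [pd_zero_of_notMem hx]; simp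
    · filter_upwards [mo_ae (hu1 j)] with x hx
      exact hx.mul_const _
  have hψ2 : Integrable (fun x => ψ x ^ 2) := (hψ.continuous.pow 2).integrable_of_hasCompactSupport (by
      apply HasCompactSupport.intro hc.isCompact fun x hx => ?_
      rw [Pi.pow_apply, image_eq_zero_of_notMem_tsupport hx]; simp)
  have bound : ∀ t : ℝ, 0 < t → |∫ x, u x j * pd i ψ x| ≤ t * ((∫ x, ψ x ^ 2) + 1) := by
    intro t ht
    obtain ⟨R, hR, hR1, hev⟩ := hD (t ^ 2) (by positivity) R0
    refine le_of_tendsto hlim.abs ?_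
    filter_upwards [hev] with n hn
    have hcz : HasCompactSupport (zR R) := HasCompactSupport.of_support_subset_isCompact (isCompact_closedBall 0 (2 * R))
      ((subset_tsupport _).trans (zR_supp (by linarith)))
    have hzi : Integrable (fun x => zR R x * ∑ i, ∑ j, pd i (vn u n j) x ^ 2) := by
      refine Continuous.integrable_of_hasCompactSupport ?_ hcz.mul_right
      have h1 := fun i j => ((hvs n j).dpd i).continuous
      have h2 := (zR_sm R).continuous
      fun_prop
    rw [ibp (hvs n j) hψ hc i, abs_neg]
    calc |∫ x, pd i (vn u n j) x * ψ x| ≤ ∫ x, |pd i (vn u n j) x * ψ x| := abs_integral_le_integral_abs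
      _ ≤ ∫ x, (t * ψ x ^ 2 + t⁻¹ * (zR R x * ∑ i, ∑ j, pd i (vn u n j) x ^ 2)) := by
          apply integral_mono
          · exact (((hvs n j).dpd i).continuous.mul hψ.continuous).integrable_of_hasCompactSupport hc.mul_left |>.abs
          · exact (hψ2.const_mul t).add (hzi.const_mul _)
          · intro x
            show |pd i (vn u n j) x * ψ x| ≤ t * ψ x ^ 2 + t⁻¹ * (zR R x * ∑ i, ∑ j, pd i (vn u n j) x ^ 2)
            have hs : pd i (vn u n j) x ^ 2 ≤ ∑ i, ∑ j, pd i (vn u n j) x ^ 2 :=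
              (Finset.single_le_sum (f := fun j => pd i (vn u n j) x ^ 2) (fun _ _ => sq_nonneg _) (Finset.mem_univ j)).trans
                (Finset.single_le_sum (f := fun i => ∑ j, pd i (vn u n j) x ^ 2) (fun _ _ => Finset.sum_nonneg fun _ _ => sq_nonneg _) (Finset.mem_univ i))
            by_cases hx : x ∈ tsupport ψ
            · have hxR : ‖x‖ ≤ R := by
                have := hR0 hx
                simp at this; linarith
              rw [zR_one (by linarith) hxR, one_mul, abs_mul]
              set a := |pd i (vn u n j) x| with ha
              set b := |ψ x|
              rw [← sq_abs (ψ x)]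
              rw [← sq_abs, ← ha] at hs
              have h1 : t⁻¹ * a ^ 2 ≤ t⁻¹ * ∑ i, ∑ j, pd i (vn u n j) x ^ 2 := by gcongr
              have h2 : 0 ≤ t * (b - t⁻¹ * a) ^ 2 := by positivity
              have h3 : t * (b - t⁻¹ * a) ^ 2 = t * b ^ 2 - 2 * (a * b) + t⁻¹ * a ^ 2 := by field_simp; ring
              have h4 : 0 ≤ a * b := by positivity
              change a * b ≤ t * b ^ 2 + _
              linarith
            · rw [image_eq_zero_of_notMem_tsupport hx]
              have := zR_nonneg R x
              simp only [mul_zero, abs_zero]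
              positivity
      _ = t * (∫ x, ψ x ^ 2) + t⁻¹ * ∫ x, zR R x * ∑ i, ∑ j, pd i (vn u n j) x ^ 2 := by
          rw [integral_add (hψ2.const_mul t) (hzi.const_mul _), integral_const_mul, integral_const_mul]
      _ ≤ t * (∫ x, ψ x ^ 2) + t⁻¹ * t ^ 2 := by gcongr
      _ = _ := by field_simp
  have hK : 0 ≤ ∫ x, ψ x ^ 2 := integral_nonneg fun x => sq_nonneg _
  by_contra h
  have hp : 0 < |∫ x, u x j * pd i ψ x| := abs_pos.2 h
  have := bound (|∫ x, u x j * pd i ψ x| / (2 * ((∫ x, ψ x ^ 2) + 1))) (by positivity)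
  have e : |∫ x, u x j * pd i ψ x| / (2 * ((∫ x, ψ x ^ 2) + 1)) * ((∫ x, ψ x ^ 2) + 1) = |∫ x, u x j * pd i ψ x| / 2 := by field_simp
  rw [e] at this
  linarith

lemma ae_const {f : E3 → ℝ} (hf : LocallyIntegrable f)
    (h : ∀ ψ : E3 → ℝ, Sm ψ → HasCompactSupport ψ → ∀ i, ∫ x, f x * pd i ψ x = 0) : ∃ c, ∀ᵐ x : E3, f x = c := by
  have hz : ∀ m i x, pd i (mo (eta m) f) x = 0 := by
    intro m i x
    rw [pd_mo (eta_sm m) (eta_hcs m) hf, mo_apply]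
    have := h (fun y => eta m (x - y)) ((eta_sm m).comp (contDiff_const.sub contDiff_id)) ((eta_hcs m).comp_homeomorph (Homeomorph.subLeft x)) i
    simp only [pd_comp_rsub _ _ (eta_sm m).diff, mul_neg, integral_neg, neg_eq_zero] at this
    simpa only [mul_comm] using this
  have hcst : ∀ m x, mo (eta m) f x = mo (eta m) f 0 := by
    intro m x
    apply is_const_of_fderiv_eq_zero (𝕜 := ℝ) (mo_sm (eta_sm m) (eta_hcs m) hf).diff
    intro y
    ext z
    have e : z = ∑ i, z i • (EuclideanSpace.single i (1:ℝ) : E3) := by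
      ext k; simp [Finset.sum_apply, Pi.single_apply]
    rw [e, map_sum]
    simp only [map_smul]
    apply Finset.sum_eq_zero
    intro i _
    have := hz m i y
    unfold pd at this
    rw [this, smul_zero]
  have hlim := mo_ae hf
  obtain ⟨x0, hx0⟩ := hlim.exists
  refine ⟨f x0, ?_⟩
  filter_upwards [hlim] with x hx
  simp only [hcst] at hx hx0
  exact tendsto_nhds_unique hx hx0

lemma final (u : E3 → E3) (P : E3 → ℝ) (hu : Measurable u) (hPm : Measurable P)
    (hu1 : ∀ j, LocallyIntegrable (fun y => u y j)) (hu2 : ∀ i j, LocallyIntegrable (fun y => u y i * u y j))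
    (hP : LocallyIntegrable P) (hweak : IsWeakSolutionNS u P)
    (hb : ∀ R : ℝ, ∃ M : ℝ, 0 ≤ M ∧ ∀ᵐ x : E3, x ∈ closedBall (0 : E3) R → ‖u x‖ ≤ M)
    (hA : ∀ ε : ℝ, 0 < ε → ∀ᶠ R : ℝ in atTop, AA u P R ≤ ENNReal.ofReal (ε * R)) : ∀ᵐ x : E3, u x = 0 := by
  obtain ⟨C, hC, hen⟩ := energy_lim u P hu hPm hu1 hu2 hP hweak hb
  have hw := fun j => ae_const (hu1 j) (fun ψ hψ hc i => weak_grad u P hu1 hb (D_small u P hC hen hA) hψ hc i j)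
  choose c hc using hw
  have hz : ∀ j, c j = 0 := by
    intro j
    by_contra hne
    have hv : 0 < volume (ball (0 : E3) 1) := measure_ball_pos _ _ (by norm_num)
    have hvt : volume (ball (0 : E3) 1) ≠ ⊤ := measure_ball_lt_top.ne
    set V := (volume (ball (0 : E3) 1)).toReal with hV
    have hV0 : 0 < V := ENNReal.toReal_pos hv.ne' hvt
    set ε := |c j| ^ 3 * V / 2 with hε
    have hε0 : 0 < ε := by have := abs_pos.2 hne; positivity
    obtain ⟨R, h1, h2⟩ := ((hA ε hε0).and (eventually_ge_atTop 1)).exists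
    have h3 : ENNReal.ofReal (|c j| ^ 3 * (R ^ 3 * V)) ≤ AA u P R := by
      calc _ = ∫⁻ x in closedBall (0 : E3) R, ENNReal.ofReal (|c j| ^ 3) := by
            rw [setLIntegral_const, Measure.addHaar_closedBall _ _ (by linarith), ENNReal.ofReal_mul (by positivity), ENNReal.ofReal_mul (by positivity), hV, ENNReal.ofReal_toReal hvt]
            simp
        _ ≤ _ := by
            apply lintegral_mono_ae
            apply ae_restrict_of_ae
            filter_upwards [hc j] with x hx
            refine le_trans ?_ le_self_add
            rw [← ofReal_norm_eq_enorm, ENNReal.ofReal_rpow_of_nonneg (norm_nonneg _) (by norm_num)]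
            apply ENNReal.ofReal_le_ofReal
            have := abs_coord (u x) j
            rw [hx] at this
            have e : ‖u x‖ ^ (3:ℝ) = ‖u x‖ ^ 3 := by norm_cast
            rw [e]
            gcongr
    have h4 := (ENNReal.ofReal_le_ofReal_iff (by positivity)).1 (h3.trans h1)
    have h5 : R * 1 ≤ R * R ^ 2 := by gcongr; nlinarith
    have h6 : 0 < |c j| ^ 3 * V := by have := abs_pos.2 hne; positivity
    rw [hε] at h4
    nlinarith
  have := ae_all_iff.2 hc
  filter_upwards [this] with x hx
  ext j
  rw [hx j, hz j]; rfl

lemma ev_small {α K ε : ℝ} (hα : α < 1) (hε : 0 < ε) : ∀ᶠ R : ℝ in atTop, K * R ^ α ≤ ε * R := by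
  have h : Tendsto (fun R : ℝ => K * R ^ (-(1 - α))) atTop (𝓝 (K * 0)) :=
    (tendsto_rpow_neg_atTop (by linarith)).const_mul K
  rw [mul_zero] at h
  filter_upwards [h.eventually_le_const hε, eventually_gt_atTop 0] with R h1 h2
  have e : R ^ α = R ^ (-(1 - α)) * R := by
    nth_rewrite 3 [← Real.rpow_one R]
    rw [← Real.rpow_add h2]; congr 1; ring
  rw [e, ← mul_assoc]
  gcongr

lemma setN_meas (σ : ℝ) : MeasurableSet (setN σ) := by
  have h : ∀ j : Fin 3, Measurable (fun x : E3 => x j) := fun j => (sm_coord j).continuous.measurable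
  have h0 := h 0; have h1 := h 1; have h2 := h 2
  have a : Measurable (fun x : E3 => (x 1) ^ 2 + (x 2) ^ 2) := by fun_prop
  have b : Measurable (fun x : E3 => (x 0) ^ (-(σ / 2))) := by fun_prop
  exact (measurableSet_lt measurable_const h0).inter (measurableSet_le a b)

/-- the region in product coordinates -/
def Np (σ R : ℝ) : Set (ℝ × (Fin 2 → ℝ)) :=
  {z | 0 < z.1 ∧ z.1 ≤ R ∧ (z.2 0) ^ 2 + (z.2 1) ^ 2 ≤ z.1 ^ (-(σ / 2))}

lemma Np_meas (σ R : ℝ) : MeasurableSet (Np σ R) := by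
  have h : ∀ j : Fin 2, Measurable (fun z : ℝ × (Fin 2 → ℝ) => z.2 j) := fun j => (measurable_pi_apply j).comp measurable_snd
  have h0 := h 0; have h1 := h 1
  have a : Measurable (fun z : ℝ × (Fin 2 → ℝ) => (z.2 0) ^ 2 + (z.2 1) ^ 2) := by fun_prop
  have b : Measurable (fun z : ℝ × (Fin 2 → ℝ) => z.1 ^ (-(σ / 2))) := by fun_prop
  exact (measurableSet_lt measurable_const measurable_fst).inter
    ((measurableSet_le measurable_fst measurable_const).inter (measurableSet_le a b))

lemma Np_vol (σ : ℝ) (hσ1 : σ < 1) {R : ℝ} (hR : 0 < R) :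
    volume (Np σ R) ≤ ENNReal.ofReal (4 * (R ^ (1 - σ / 2) / (1 - σ / 2))) := by
  rw [Measure.volume_eq_prod, Measure.prod_apply (Np_meas σ R)]
  have hintg : IntervalIntegrable (fun t : ℝ => 4 * t ^ (-(σ / 2))) volume 0 R :=
    (intervalIntegral.intervalIntegrable_rpow' (by linarith)).const_mul 4
  calc _ ≤ ∫⁻ t in Set.Ioc 0 R, ENNReal.ofReal (4 * t ^ (-(σ / 2))) := by
        rw [← lintegral_indicator measurableSet_Ioc]
        apply lintegral_mono
        intro t
        by_cases ht : t ∈ Set.Ioc 0 R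
        · rw [Set.indicator_of_mem ht]
          set m := t ^ (-(σ / 2)) with hm
          have hm0 : 0 ≤ m := Real.rpow_nonneg ht.1.le _
          have hsub : Prod.mk t ⁻¹' Np σ R ⊆ Set.Icc (fun _ : Fin 2 => -Real.sqrt m) (fun _ => Real.sqrt m) := by
            rintro y ⟨_, _, hy⟩
            change (y 0) ^ 2 + (y 1) ^ 2 ≤ m at hy
            have k0 : |y 0| ≤ Real.sqrt m := Real.abs_le_sqrt (by nlinarith [sq_nonneg (y 1)])
            have k1 : |y 1| ≤ Real.sqrt m := Real.abs_le_sqrt (by nlinarith [sq_nonneg (y 0)])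
            rw [abs_le] at k0 k1
            constructor
            · intro i; fin_cases i
              · exact k0.1
              · exact k1.1
            · intro i; fin_cases i
              · exact k0.2
              · exact k1.2
          refine (measure_mono hsub).trans ?_
          rw [Real.volume_Icc_pi]
          simp only [Finset.prod_const, Finset.card_univ, Fintype.card_fin]
          rw [← ENNReal.ofReal_pow (by have := Real.sqrt_nonneg m; linarith)]
          apply ENNReal.ofReal_le_ofReal
          have := Real.sq_sqrt hm0
          nlinarith
        · rw [Set.indicator_of_notMem ht]
          have : Prod.mk t ⁻¹' Np σ R = ∅ := by
            ext y; simp only [Set.mem_preimage, Set.mem_empty_iff_false, iff_false]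
            rintro ⟨h1, h2, _⟩
            exact ht ⟨h1, h2⟩
          show volume (Prod.mk t ⁻¹' Np σ R) ≤ 0
          rw [this]; simp
    _ = ENNReal.ofReal (∫ t in Set.Ioc 0 R, 4 * t ^ (-(σ / 2))) := by
        rw [ofReal_integral_eq_lintegral_ofReal]
        · exact hintg.1
        · filter_upwards [ae_restrict_mem measurableSet_Ioc] with t ht
          have := Real.rpow_nonneg ht.1.le (-(σ/2))
          show 0 ≤ 4 * t ^ (-(σ / 2))
          positivity
    _ = _ := by
        rw [← intervalIntegral.integral_of_le hR.le, intervalIntegral.integral_const_mul, integral_rpow (Or.inl (by linarith))]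
        have e : -(σ / 2) + 1 = 1 - σ / 2 := by ring
        rw [e, Real.zero_rpow (by linarith), sub_zero]

lemma setN_vol (σ : ℝ) (hσ1 : σ < 1) {R : ℝ} (hR : 0 < R) :
    volume (setN σ ∩ closedBall 0 R) ≤ ENNReal.ofReal (4 * (R ^ (1 - σ / 2) / (1 - σ / 2))) := by
  refine le_trans ?_ (Np_vol σ hσ1 hR)
  have m1 := EuclideanSpace.volume_preserving_symm_measurableEquiv_toLp (Fin 3)
  have m2 := volume_preserving_piFinSuccAbove (fun _ : Fin 3 => ℝ) 0
  have m3 := m2.comp m1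
  rw [← m3.measure_preimage (Np_meas σ R).nullMeasurableSet]
  apply measure_mono
  rintro x ⟨⟨h1, h2⟩, h3⟩
  refine ⟨h1, ?_, h2⟩
  have := abs_coord x 0
  simp at h3
  exact (le_abs_self _).trans (this.trans h3)

/-- normalized membership -/
def MemP (σ : ℝ) (p : E3 → ℝ≥0∞) (w : E3 → ℝ) : Prop :=
  (∀ x, 0 ≤ w x) ∧ (∀ᵐ x : E3, x ∈ setN σ → w x ≤ 1) ∧
    ∫⁻ x in (setN σ)ᶜ, ENNReal.ofReal (w x ^ (p x).toReal) ≤ 1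

lemma memP_of (σ : ℝ) (p r : E3 → ℝ≥0∞) (hr : Measurable r) (κ : ℝ) (hκ : 0 < κ)
    (hin : ∀ x ∈ setN σ, r x = ⊤)
    (hout : ∀ᵐ x : E3, x ∉ setN σ → r x ≠ ⊤ ∧ (r x).toReal = (p x).toReal * κ)
    (f : E3 → ℝ) (hf : Measurable f) (h : modularE r f ≤ 1) : MemP σ p (fun x => |f x| ^ κ) := by
  unfold modularE at h
  have hm : Measurable (fun x => if r x = ⊤ then (if |f x| ≤ 1 then (0:ℝ≥0∞) else ⊤) else ENNReal.ofReal (|f x| ^ (r x).toReal)) := by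
    apply Measurable.ite
    · exact hr (measurableSet_singleton _)
    · exact Measurable.ite (measurableSet_le (by fun_prop) (by fun_prop)) measurable_const measurable_const
    · fun_prop
  refine ⟨fun x => by positivity, ?_, ?_⟩
  · filter_upwards [ae_lt_top hm (h.trans_lt ENNReal.one_lt_top).ne] with x hx hN
    rw [if_pos (hin x hN)] at hx
    have : |f x| ≤ 1 := by
      by_contra hc
      rw [if_neg hc] at hx
      exact lt_irrefl _ hx
    exact Real.rpow_le_one (abs_nonneg _) this hκ.le
  · refine le_trans ?_ h
    refine le_trans ?_ (setLIntegral_le_lintegral (setN σ)ᶜ _)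
    apply lintegral_mono_ae
    filter_upwards [ae_restrict_mem (setN_meas σ).compl, ae_restrict_of_ae hout] with x hx ho
    obtain ⟨h1, h2⟩ := ho hx
    rw [if_neg h1, h2, ← Real.rpow_mul (abs_nonneg _), mul_comm]

lemma cube_split {w τ s b : ℝ} (hw : 0 ≤ w) (hτ : 0 < τ) (hτ1 : τ ≤ 1) (hs : 3 ≤ s) (hb : s ≤ b) :
    w ^ 3 ≤ τ ^ 3 + τ ^ (-(b - 3)) * w ^ s := by
  by_cases h : w ≤ τ
  · have : w ^ 3 ≤ τ ^ 3 := by gcongr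
    have : 0 ≤ τ ^ (-(b - 3)) * w ^ s := by positivity
    linarith
  · have h : τ < w := by linarith
    have hw0 : 0 < w := by linarith
    have e : w ^ s = w ^ (s - 3) * w ^ 3 := by
      have : w ^ 3 = w ^ (3:ℝ) := by norm_cast
      rw [this, ← Real.rpow_add hw0]; congr 1; ring
    have h1 : τ ^ (b - 3) ≤ w ^ (s - 3) :=
      (Real.rpow_le_rpow_of_exponent_ge hτ hτ1 (by linarith)).trans (Real.rpow_le_rpow hτ.le h.le (by linarith))
    have h2 : τ ^ (-(b - 3)) * τ ^ (b - 3) = 1 := by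
      rw [← Real.rpow_add hτ]; simp
    have h3 : 1 ≤ τ ^ (-(b - 3)) * w ^ (s - 3) := by
      rw [← h2]; gcongr
    have h4 : 1 * w ^ 3 ≤ τ ^ (-(b - 3)) * w ^ (s - 3) * w ^ 3 := by gcongr
    have : 0 ≤ τ ^ 3 := by positivity
    rw [e]
    nlinarith

lemma memP_growth (σ : ℝ) (hσ0 : 0 < σ) (hσ1 : σ < 1) (p : E3 → ℝ≥0∞) {b : ℝ} (hb3 : 3 < b) (hb : b < 9 / 2)
    (hp : ∀ᵐ x : E3, x ∉ setN σ → 3 ≤ (p x).toReal ∧ (p x).toReal ≤ b)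
    (w : E3 → ℝ) (hpm : Measurable p) (hw : Measurable w) (h : MemP σ p w) (ε : ℝ) (hε : 0 < ε) :
    ∀ᶠ R : ℝ in atTop, ∫⁻ x in closedBall (0 : E3) R, ENNReal.ofReal (w x ^ 3) ≤ ENNReal.ofReal (ε * R) := by
  obtain ⟨hw0, hN, hI⟩ := h
  obtain ⟨θ, hθ1, hθ2⟩ : ∃ θ : ℝ, 2 / 3 < θ ∧ θ < 1 / (b - 3) := exists_between (by
    rw [lt_div_iff₀ (by linarith)]; linarith)
  rw [lt_div_iff₀ (by linarith)] at hθ2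
  set V := (volume (ball (0 : E3) 1)).toReal with hV
  have hvt : volume (ball (0 : E3) 1) ≠ ⊤ := measure_ball_lt_top.ne
  filter_upwards [ev_small (α := 1 - σ / 2) (K := 4 / (1 - σ / 2)) (by linarith) (show 0 < ε / 3 by positivity),
    ev_small (α := 3 - 3 * θ) (K := V) (by linarith) (show 0 < ε / 3 by positivity),
    ev_small (α := θ * (b - 3)) (K := 1) (by linarith) (show 0 < ε / 3 by positivity), eventually_ge_atTop 1] with R e1 e2 e3 hR
  have hR0 : 0 < R := by linarith
  set τ : ℝ := R ^ (-θ) with hτ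
  have hτ0 : 0 < τ := Real.rpow_pos_of_pos hR0 _
  have hτ1 : τ ≤ 1 := Real.rpow_le_one_of_one_le_of_nonpos hR (by linarith)
  have hb1 : ∫⁻ x in closedBall (0 : E3) R ∩ setN σ, ENNReal.ofReal (w x ^ 3) ≤ ENNReal.ofReal (ε / 3 * R) := by
    calc _ ≤ ∫⁻ x in closedBall (0 : E3) R ∩ setN σ, 1 := by
          apply lintegral_mono_ae
          filter_upwards [ae_restrict_mem (measurableSet_closedBall.inter (setN_meas σ)), ae_restrict_of_ae hN] with x hx h1
          rw [← ENNReal.ofReal_one]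
          exact ENNReal.ofReal_le_ofReal (pow_le_one₀ (hw0 x) (h1 hx.2))
      _ = volume (setN σ ∩ closedBall 0 R) := by rw [setLIntegral_one, Set.inter_comm]
      _ ≤ _ := setN_vol σ hσ1 hR0
      _ ≤ _ := by
          apply ENNReal.ofReal_le_ofReal
          refine le_trans (le_of_eq ?_) e1
          ring
  have hb2 : ∫⁻ x in closedBall (0 : E3) R ∩ (setN σ)ᶜ, ENNReal.ofReal (w x ^ 3) ≤ ENNReal.ofReal (ε / 3 * R) + ENNReal.ofReal (ε / 3 * R) := by
    calc _ ≤ ∫⁻ x in closedBall (0 : E3) R ∩ (setN σ)ᶜ, (ENNReal.ofReal (τ ^ 3) + ENNReal.ofReal (τ ^ (-(b - 3))) * ENNReal.ofReal (w x ^ (p x).toReal)) := by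
          apply lintegral_mono_ae
          filter_upwards [ae_restrict_mem (measurableSet_closedBall.inter (setN_meas σ).compl), ae_restrict_of_ae hp] with x hx h1
          obtain ⟨h1, h2⟩ := h1 hx.2
          rw [← ENNReal.ofReal_mul (by positivity), ← ENNReal.ofReal_add (by positivity) (mul_nonneg (by positivity) (Real.rpow_nonneg (hw0 x) _))]
          exact ENNReal.ofReal_le_ofReal (cube_split (hw0 x) hτ0 hτ1 h1 h2)
      _ = ENNReal.ofReal (τ ^ 3) * volume (closedBall (0 : E3) R ∩ (setN σ)ᶜ) + ENNReal.ofReal (τ ^ (-(b - 3))) * ∫⁻ x in closedBall (0 : E3) R ∩ (setN σ)ᶜ, ENNReal.ofReal (w x ^ (p x).toReal) := by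
          rw [lintegral_add_left measurable_const, setLIntegral_const, lintegral_const_mul' _ _ ENNReal.ofReal_ne_top]
      _ ≤ ENNReal.ofReal (τ ^ 3) * volume (closedBall (0 : E3) R) + ENNReal.ofReal (τ ^ (-(b - 3))) * 1 := by
          gcongr
          · exact Set.inter_subset_left
          · exact (lintegral_mono_set Set.inter_subset_right).trans hI
      _ ≤ _ := by
          rw [Measure.addHaar_closedBall _ _ hR0.le, mul_one]
          simp only [finrank_euclideanSpace, Fintype.card_fin]
          rw [← ENNReal.ofReal_toReal hvt, ← ENNReal.ofReal_mul (by positivity), ← ENNReal.ofReal_mul (by positivity), ← hV]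
          have k1 : τ ^ 3 * (R ^ 3 * V) = V * R ^ (3 - 3 * θ) := by
            have : R ^ (3 - 3 * θ) = τ ^ 3 * R ^ 3 := by
              rw [hτ, ← Real.rpow_natCast, ← Real.rpow_natCast, ← Real.rpow_mul hR0.le, ← Real.rpow_add hR0]
              congr 1; push_cast; ring
            rw [this]; ring
          have k2 : τ ^ (-(b - 3)) = 1 * R ^ (θ * (b - 3)) := by
            rw [hτ, ← Real.rpow_mul hR0.le, one_mul]; congr 1; ring
          rw [k1, k2]
          exact add_le_add (ENNReal.ofReal_le_ofReal e2) (ENNReal.ofReal_le_ofReal e3)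
  rw [← lintegral_inter_add_diff _ _ (setN_meas σ), Set.diff_eq]
  refine (add_le_add hb1 hb2).trans (le_of_eq ?_)
  rw [← ENNReal.ofReal_add (by positivity) (by positivity), ← ENNReal.ofReal_add (by positivity) (by positivity)]
  congr 1; ring

lemma memP_loc (σ : ℝ) (p : E3 → ℝ≥0∞) {a : ℝ} (ha3 : 0 < a) 
    (hp : ∀ᵐ x : E3, x ∉ setN σ → a ≤ (p x).toReal)
    (w : E3 → ℝ) (h : MemP σ p w) (R : ℝ) :
    ∫⁻ x in ball (0 : E3) R, ENNReal.ofReal (w x ^ a) < ⊤ := by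
  obtain ⟨hw0, hN, hI⟩ := h
  rw [← lintegral_inter_add_diff _ _ (setN_meas σ), Set.diff_eq]
  have hv : volume (ball (0 : E3) R) < ⊤ := measure_ball_lt_top
  apply ENNReal.add_lt_top.2 ⟨?_, ?_⟩
  · calc _ ≤ ∫⁻ x in ball (0 : E3) R ∩ setN σ, 1 := by
          apply lintegral_mono_ae
          filter_upwards [ae_restrict_mem (measurableSet_ball.inter (setN_meas σ)), ae_restrict_of_ae hN] with x hx h1
          rw [← ENNReal.ofReal_one]
          exact ENNReal.ofReal_le_ofReal (Real.rpow_le_one (hw0 x) (h1 hx.2) ha3.le)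
      _ ≤ volume (ball (0 : E3) R) := by rw [setLIntegral_one]; exact measure_mono Set.inter_subset_left
      _ < _ := hv
  · calc _ ≤ ∫⁻ x in ball (0 : E3) R ∩ (setN σ)ᶜ, (1 + ENNReal.ofReal (w x ^ (p x).toReal)) := by
          apply lintegral_mono_ae
          filter_upwards [ae_restrict_mem (measurableSet_ball.inter (setN_meas σ).compl), ae_restrict_of_ae hp] with x hx h1
          have h1 := h1 hx.2
          rw [← ENNReal.ofReal_rpow_of_nonneg (hw0 x) ha3.le, ← ENNReal.ofReal_rpow_of_nonneg (hw0 x) (by linarith)]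
          exact rpow_le_one_add ha3.le h1
      _ ≤ volume (ball (0 : E3) R) + 1 := by
          rw [lintegral_add_left measurable_const, setLIntegral_one]
          exact add_le_add (measure_mono Set.inter_subset_left) ((lintegral_mono_set Set.inter_subset_right).trans hI)
      _ < _ := by finiteness

lemma main_aux (σ : ℝ) (hσ0 : 0 < σ) (hσ1 : σ < 1) (p : E3 → ℝ≥0∞) (hpmeas : Measurable p)
    (hout_lb : 3 < essInf p (volume.restrict (setN σ)ᶜ))
    (hout_le : essInf p (volume.restrict (setN σ)ᶜ) ≤ essSup p (volume.restrict (setN σ)ᶜ))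
    (hout_ub : essSup p (volume.restrict (setN σ)ᶜ) < 9 / 2)
    (hin : ∀ x ∈ setN σ, p x = ⊤) (u : E3 → E3) (P : E3 → ℝ)
    (hu_meas : Measurable u) (hP_meas : Measurable P)
    (hu_loc : LocallyIntegrable (fun x => ‖u x‖ ^ 2) volume) (hP_loc : LocallyIntegrable P volume)
    (hweak : IsWeakSolutionNS u P) (hu_p : MemVarLpE p (fun x => ‖u x‖))
    (hP_p : MemVarLpE (fun x => p x / 2) P) : ∀ᵐ x : E3, u x = 0 := by
  set pm := essInf p (volume.restrict (setN σ)ᶜ) with hpm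
  set pM := essSup p (volume.restrict (setN σ)ᶜ) with hpM
  have h92 : (9 / 2 : ℝ≥0∞) = ENNReal.ofReal (9 / 2) := by
    rw [ENNReal.ofReal_div_of_pos (by norm_num)]; norm_num
  have hMt : pM ≠ ⊤ := (hout_ub.trans_le (by rw [h92]; exact le_top)).ne
  have hmt : pm ≠ ⊤ := (hout_le.trans_lt hMt.lt_top).ne
  set a := pm.toReal with ha
  set b := pM.toReal with hb
  have ha3 : 3 < a := by
    have := (ENNReal.toReal_lt_toReal (by norm_num) hmt).2 hout_lb
    simpa using this
  have hab : a ≤ b := ENNReal.toReal_mono hMt hout_le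
  have hb9 : b < 9 / 2 := by
    rw [h92] at hout_ub
    have := (ENNReal.toReal_lt_toReal hMt ENNReal.ofReal_ne_top).2 hout_ub
    rwa [ENNReal.toReal_ofReal (by norm_num)] at this
  have hpx : ∀ᵐ x : E3, x ∉ setN σ → p x ≠ ⊤ ∧ a ≤ (p x).toReal ∧ (p x).toReal ≤ b := by
    have h1 := (ae_restrict_iff' (setN_meas σ).compl).1 (ae_essInf_le (f := p) (μ := volume.restrict (setN σ)ᶜ))
    have h2 := (ae_restrict_iff' (setN_meas σ).compl).1 (ae_le_essSup (f := p) (μ := volume.restrict (setN σ)ᶜ))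
    filter_upwards [h1, h2] with x h1 h2 hx
    have h1 := h1 hx
    have h2 := h2 hx
    have ht : p x ≠ ⊤ := (h2.trans_lt hMt.lt_top).ne
    exact ⟨ht, ENNReal.toReal_mono ht h1, ENNReal.toReal_mono hMt h2⟩
  obtain ⟨l, hl, hl1⟩ := hu_p
  obtain ⟨k, hk, hk1⟩ := hP_p
  have hwu : MemP σ p (fun x => |‖u x‖ / l| ^ (1:ℝ)) := memP_of σ p p hpmeas 1 one_pos hin (by
    filter_upwards [hpx] with x hx hN
    exact ⟨(hx hN).1, by simp⟩) _ (hu_meas.norm.div_const l) hl1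
  have hwP : MemP σ p (fun x => |P x / k| ^ (1/2:ℝ)) := memP_of σ p (fun x => p x / 2) (hpmeas.div_const 2) (1/2) (by norm_num)
    (fun x hx => by
      show p x / 2 = ⊤
      rw [hin x hx]; exact ENNReal.top_div_of_ne_top (by norm_num)) (by
    filter_upwards [hpx] with x hx hN
    refine ⟨ENNReal.div_ne_top (hx hN).1 (by norm_num), ?_⟩
    rw [ENNReal.toReal_div]; simp; ring) _ (hP_meas.div_const k) hk1
  simp only [Real.rpow_one] at hwu
  have hul : LocallyIntegrable u volume := by
    have h1 : LocallyIntegrable (fun x : E3 => 1 + ‖u x‖ ^ 2) volume := (locallyIntegrable_const 1).add hu_loc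
    refine h1.mono hu_meas.aestronglyMeasurable (Eventually.of_forall fun x => ?_)
    rw [Real.norm_of_nonneg (by positivity)]
    nlinarith [sq_nonneg (‖u x‖ - 1)]
  have hu1 : ∀ j, LocallyIntegrable (fun y => u y j) := fun j =>
    hul.mono (meas_coord hu_meas j).aestronglyMeasurable (Eventually.of_forall fun x => abs_coord _ _)
  have hu2 : ∀ i j, LocallyIntegrable (fun y => u y i * u y j) := fun i j =>
    hu_loc.mono ((meas_coord hu_meas i).mul (meas_coord hu_meas j)).aestronglyMeasurable (Eventually.of_forall fun x => by
      rw [norm_mul, norm_pow, norm_norm, sq]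
      exact mul_le_mul (abs_coord _ _) (abs_coord _ _) (norm_nonneg _) (norm_nonneg _))
  have hloc : ∀ R, ∫⁻ x in ball (0 : E3) R, ‖u x‖ₑ ^ a < ⊤ := by
    intro R
    have h1 := memP_loc σ p (a := a) (by linarith) (by filter_upwards [hpx] with x hx hN using (hx hN).2.1) _ hwu R
    have e : ∀ x, ‖u x‖ₑ ^ a = ENNReal.ofReal (l ^ a) * ENNReal.ofReal (|‖u x‖ / l| ^ a) := by
      intro x
      rw [← ENNReal.ofReal_mul (by positivity), ← Real.mul_rpow hl.le (abs_nonneg _), abs_of_nonneg (by positivity),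
        mul_div_cancel₀ _ hl.ne', ← ofReal_norm_eq_enorm, ENNReal.ofReal_rpow_of_nonneg (norm_nonneg _) (by linarith)]
    simp only [e]
    rw [lintegral_const_mul' _ _ ENNReal.ofReal_ne_top]
    exact ENNReal.mul_lt_top ENNReal.ofReal_lt_top h1
  have hbd : ∀ R : ℝ, ∃ M : ℝ, 0 ≤ M ∧ ∀ᵐ x : E3, x ∈ closedBall (0 : E3) R → ‖u x‖ ≤ M := by
    intro R
    obtain ⟨M, hM, h⟩ := boot u P hu_meas hul hweak ha3 hloc (R + 1)
    refine ⟨M.toReal, ENNReal.toReal_nonneg, ?_⟩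
    filter_upwards [h] with x hx hxR
    have := hx (closedBall_subset_ball (by linarith) hxR)
    have := ENNReal.toReal_mono hM this
    simpa using this
  refine final u P hu_meas hP_meas hu1 hu2 hP_loc hweak hbd ?_
  intro ε hε
  have hp3 : ∀ᵐ x : E3, x ∉ setN σ → 3 ≤ (p x).toReal ∧ (p x).toReal ≤ b := by
    filter_upwards [hpx] with x hx hN
    exact ⟨ha3.le.trans (hx hN).2.1, (hx hN).2.2⟩
  have hb3 : 3 < b := by linarith
  have g1 := memP_growth σ hσ0 hσ1 p hb3 hb9 hp3 _ hpmeas (by fun_prop) hwu (ε / (2 * l ^ 3)) (by positivity)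
  have g2 := memP_growth σ hσ0 hσ1 p hb3 hb9 hp3 _ hpmeas (by fun_prop) hwP (ε / (2 * k ^ (3/2:ℝ))) (by positivity)
  filter_upwards [g1, g2, eventually_gt_atTop 0] with R g1 g2 hR
  have e1 : ∀ x, ‖u x‖ₑ ^ (3:ℝ) = ENNReal.ofReal (l ^ 3) * ENNReal.ofReal (|‖u x‖ / l| ^ 3) := by
    intro x
    rw [← ENNReal.ofReal_mul (by positivity), ← mul_pow, abs_of_nonneg (by positivity),
        mul_div_cancel₀ _ hl.ne', ← ofReal_norm_eq_enorm, ENNReal.ofReal_rpow_of_nonneg (norm_nonneg _) (by norm_num)]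
    norm_cast
  have e2 : ∀ x, ‖P x‖ₑ ^ (3/2:ℝ) = ENNReal.ofReal (k ^ (3/2:ℝ)) * ENNReal.ofReal ((|P x / k| ^ (1/2:ℝ)) ^ 3) := by
    intro x
    rw [← Real.rpow_natCast, ← Real.rpow_mul (abs_nonneg _), ← ENNReal.ofReal_mul (by positivity)]
    have : (1/2:ℝ) * ((3:ℕ):ℝ) = 3/2 := by norm_num
    rw [this, ← Real.mul_rpow hk.le (abs_nonneg _), abs_div, abs_of_pos hk,
        mul_div_cancel₀ _ hk.ne', Real.enorm_eq_ofReal_abs, ENNReal.ofReal_rpow_of_nonneg (abs_nonneg _) (by norm_num)]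
  unfold AA
  rw [lintegral_add_left (by fun_prop)]
  simp only [e1, e2]
  rw [lintegral_const_mul' _ _ ENNReal.ofReal_ne_top, lintegral_const_mul' _ _ ENNReal.ofReal_ne_top]
  calc _ ≤ ENNReal.ofReal (l ^ 3) * ENNReal.ofReal (ε / (2 * l ^ 3) * R) + ENNReal.ofReal (k ^ (3/2:ℝ)) * ENNReal.ofReal (ε / (2 * k ^ (3/2:ℝ)) * R) := by gcongr
    _ = ENNReal.ofReal (ε * R) := by
        rw [← ENNReal.ofReal_mul (by positivity), ← ENNReal.ofReal_mul (by positivity), ← ENNReal.ofReal_add (by positivity) (by positivity)]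
        congr 1
        have : 0 < k ^ (3/2:ℝ) := by positivity
        field_simp; ring

/-- **Theorem 3.** Liouville theorem for the stationary Navier–Stokes equations with a
variable exponent equal to `∞` on the region `𝒩`. -/
theorem liouville_NS_infinite_exponent
    (σ : ℝ) (hσ0 : 0 < σ) (hσ1 : σ < 1)
    (p : E3 → ℝ≥0∞) (hpmeas : Measurable p) (hp1 : ∀ x, 1 ≤ p x)
    (hout_lb : (3 : ℝ≥0∞) < essInf p (volume.restrict (setN σ)ᶜ))
    (hout_le : essInf p (volume.restrict (setN σ)ᶜ) ≤ essSup p (volume.restrict (setN σ)ᶜ))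
    (hout_ub : essSup p (volume.restrict (setN σ)ᶜ) < 9 / 2)
    (hin : ∀ x ∈ setN σ, p x = ⊤)
    (u : E3 → E3) (P : E3 → ℝ)
    (hu_meas : Measurable u) (hP_meas : Measurable P)
    (hu_loc : LocallyIntegrable (fun x => ‖u x‖ ^ 2) volume)
    (hP_loc : LocallyIntegrable P volume)
    (hweak : IsWeakSolutionNS u P)
    (hu_p : MemVarLpE p (fun x => ‖u x‖))
    (hP_p : MemVarLpE (fun x => p x / 2) P) :
    ∀ᵐ x : E3, u x = 0 := by
  exact main_aux σ hσ0 hσ1 p hpmeas hout_lb hout_le hout_ub hin u P hu_meas hP_meas hu_loc hP_loc hweak hu_p hP_p
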